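/- Drift condition for the particle count: for the KCIP on the torus Λ(L,d) with parameter p=c/n (d≥3 fixed, c fixed), there exists ε₀=ε₀(c,d)>0 such that for every 0<ε<ε₀ there are constants C<∞, α∈(0,1), and N (all depending only on ε,c,d) so that for all n>N, every integer k≥1, and every initial configuration x: E_x[V_{k·⌊εn³⌋}] ≤ (1−α)^k·V_0(x) + C. -/

import Mathlib

open scoped Classical
open Finset

noncomputable section

/-- The number of particles (vertices labelled `1`) of a configuration. -/
def numParticles {V : Type*} [Fintype V] (x : V → Bool) : ℕ :=
  (Finset.univ.filter fun v => x v = true).card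

/-- One-step transition kernel of the kinetically constrained Ising process (KCIP)
on the graph `G` with density parameter `p`: a uniformly chosen vertex `v` is updated,
and its label is resampled (to `1` with probability `p`, to `0` otherwise) iff `v` has at
least one neighbour labelled `1`. -/
def kcipKernel {V : Type*} [Fintype V] (G : SimpleGraph V) (p : ℝ) (x y : V → Bool) : ℝ :=
  ((Fintype.card V : ℝ))⁻¹ * ∑ v : V,
    (if ∀ w, w ≠ v → y w = x w then
      (if ∃ u, G.Adj u v ∧ x u = true then (if y v = true then p else 1 - p)
       else (if y v = x v then 1 else 0))
     else 0)

/-- Probability that the Markov chain with kernel `K` started at `x` produces a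
trajectory `(X_0, …, X_T)` lying in the event `A`. -/
def trajProb {Ω : Type*} [Fintype Ω] (K : Ω → Ω → ℝ) (x : Ω) (T : ℕ)
    (A : (Fin (T + 1) → Ω) → Prop) : ℝ :=
  ∑ ω : Fin (T + 1) → Ω,
    if ω 0 = x ∧ A ω then ∏ i : Fin T, K (ω i.castSucc) (ω i.succ) else 0

/-- Expectation of a functional `f` of the trajectory `(X_0, …, X_T)` of the Markov chain
with kernel `K` started at `x`. -/
def trajExp {Ω : Type*} [Fintype Ω] (K : Ω → Ω → ℝ) (x : Ω) (T : ℕ)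
    (f : (Fin (T + 1) → Ω) → ℝ) : ℝ :=
  ∑ ω : Fin (T + 1) → Ω,
    (if ω 0 = x then ∏ i : Fin T, K (ω i.castSucc) (ω i.succ) else 0) * f ω

/-- The `d`-dimensional discrete torus `Z_L^d`: vertices are `Fin d → ZMod L`, with an edge
between `u` and `v` iff `u - v = ± e_i` for some coordinate vector `e_i`. -/
def torusGraph (L d : ℕ) : SimpleGraph (Fin d → ZMod L) :=
  SimpleGraph.fromRel fun u v => ∃ i : Fin d, v = u + fun j => if j = i then (1 : ZMod L) else 0

section MarkovOperator

variable {Ω : Type*} [Fintype Ω]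

/-- The Markov operator associated with the kernel `K`. -/
def markovOp (K : Ω → Ω → ℝ) (f : Ω → ℝ) (x : Ω) : ℝ := ∑ y, K x y * f y

theorem trajExp_last_eq_iterate (K : Ω → Ω → ℝ) (f : Ω → ℝ) (T : ℕ) (x : Ω) :
    trajExp K x T (fun ω => f (ω (Fin.last T))) = ((markovOp K)^[T] f) x := by
  induction T generalizing x with
  | zero =>
    unfold trajExp
    rw [← (Equiv.funUnique (Fin 1) Ω).symm.sum_comp]
    simp [Equiv.funUnique]
  | succ T ih =>
    rw [Function.iterate_succ_apply']
    unfold trajExp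
    rw [← (Fin.consEquiv (fun _ : Fin (T + 2) => Ω)).sum_comp, Fintype.sum_prod_type]
    simp only [Fin.consEquiv_apply, Fin.cons_zero, Fin.prod_univ_succ, Fin.castSucc_zero,
      ← Fin.succ_castSucc, Fin.cons_succ, ← Fin.succ_last]
    rw [Finset.sum_eq_single x]
    · simp only [if_true, markovOp]
      simp_rw [← ih, trajExp, Finset.mul_sum]
      rw [Finset.sum_comm]
      refine Finset.sum_congr rfl fun ω _ => ?_
      rw [Finset.sum_eq_single (ω 0)]
      · simp [mul_assoc]
      · intro y _ hy
        simp [hy.symm]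
      · simp
    · intro y _ hy
      simp [hy]
    · simp

theorem markovOp_mono {K : Ω → Ω → ℝ} (hK : ∀ x y, 0 ≤ K x y) {f g : Ω → ℝ}
    (h : ∀ x, f x ≤ g x) (x : Ω) : markovOp K f x ≤ markovOp K g x :=
  Finset.sum_le_sum fun y _ => mul_le_mul_of_nonneg_left (h y) (hK x y)

theorem iterate_markovOp_mono {K : Ω → Ω → ℝ} (hK : ∀ x y, 0 ≤ K x y) (T : ℕ) {f g : Ω → ℝ}
    (h : ∀ x, f x ≤ g x) (x : Ω) : ((markovOp K)^[T] f) x ≤ ((markovOp K)^[T] g) x := by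
  induction T generalizing x with
  | zero => exact h x
  | succ T ih =>
    rw [Function.iterate_succ_apply', Function.iterate_succ_apply']
    exact markovOp_mono hK ih x

theorem iterate_markovOp_linear (K : Ω → Ω → ℝ) (T : ℕ) (f g : Ω → ℝ) (a b : ℝ) (x : Ω) :
    ((markovOp K)^[T] (fun x => a * f x + b * g x)) x =
      a * ((markovOp K)^[T] f) x + b * ((markovOp K)^[T] g) x := by
  induction T generalizing x with
  | zero => rfl
  | succ T ih =>
    simp only [Function.iterate_succ_apply']
    rw [funext ih]
    simp only [markovOp, mul_add, Finset.sum_add_distrib, Finset.mul_sum]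
    congr 1 <;> exact Finset.sum_congr rfl fun y _ => by ring

theorem iterate_markovOp_one {K : Ω → Ω → ℝ} (hK : ∀ x, ∑ y, K x y = 1) (T : ℕ) (x : Ω) :
    ((markovOp K)^[T] (fun _ => 1)) x = 1 := by
  induction T generalizing x with
  | zero => rfl
  | succ T ih =>
    rw [Function.iterate_succ_apply', funext ih]
    simp [markovOp, hK]

/-- If `V` contracts up to a constant in `T` steps, it contracts geometrically along multiples
of `T`. -/
theorem iterate_markovOp_geometric {K : Ω → Ω → ℝ} (hK : ∀ x y, 0 ≤ K x y)
    (hK1 : ∀ x, ∑ y, K x y = 1) {V : Ω → ℝ} {T : ℕ} {C : ℝ} (hC : 0 ≤ C)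
    (h : ∀ x, ((markovOp K)^[T] V) x ≤ V x / 2 + C) (k : ℕ) (x : Ω) :
    ((markovOp K)^[k * T] V) x ≤ (1 - 1 / 2) ^ k * V x + 2 * C := by
  have key : ∀ x, ((markovOp K)^[k * T] V) x ≤
      (1 - 1 / 2) ^ k * V x + 2 * C * (1 - (1 - 1 / 2) ^ k) := by
    induction k with
    | zero => intro x; simp
    | succ k ih =>
      intro x
      rw [Nat.succ_mul, Nat.add_comm, Function.iterate_add_apply]
      set q : ℝ := (1 - 1 / 2) ^ k with hq
      calc ((markovOp K)^[T] ((markovOp K)^[k * T] V)) x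
          ≤ ((markovOp K)^[T] (fun x => q * V x + 2 * C * (1 - q) * 1)) x :=
            iterate_markovOp_mono hK T (fun x => by simpa using ih x) x
        _ = q * ((markovOp K)^[T] V) x + 2 * C * (1 - q) * 1 := by
            rw [iterate_markovOp_linear K T V (fun _ => 1), iterate_markovOp_one hK1]
        _ ≤ q * (V x / 2 + C) + 2 * C * (1 - q) * 1 := by
            have hq0 : 0 ≤ q := pow_nonneg (by norm_num) _
            have := mul_le_mul_of_nonneg_left (h x) hq0
            linarith
        _ = _ := by rw [pow_succ]; ring
  have hq0 : (0 : ℝ) ≤ (1 - 1 / 2) ^ k := pow_nonneg (by norm_num) _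
  nlinarith [key x, mul_nonneg hC hq0]

/-- If `Q` decreases at rate `a V ^ 2` up to an error, and the growth of `Y`, which is comparable
to `V`, is controlled, then the expectation of `V` is controlled by its past second moments. -/
theorem iterate_markovOp_le_of_lyapunov {K : Ω → Ω → ℝ} (hK : ∀ x y, 0 ≤ K x y)
    (hK1 : ∀ x, ∑ y, K x y = 1) {V Y Q : Ω → ℝ} {a b r κ : ℝ} {T : ℕ} (hT : 0 < T) (hr : 0 ≤ r)
    (hκ : 0 ≤ κ) (hQ0 : ∀ x, 0 ≤ Q x) (hVY : ∀ x, V x ≤ 2 * Y x) (hYV : ∀ x, Y x ≤ κ * V x)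
    (hY : ∀ x, markovOp K Y x ≤ (1 + r) * Y x) (hV0 : ∀ x, 0 ≤ V x)
    (hQ : ∀ x, markovOp K Q x ≤ Q x + (-a * V x ^ 2 + b)) (ρ : ℝ) (hρ : 0 < ρ) (ha : 0 < a)
    (x : Ω) :
    ((markovOp K)^[T] V) x ≤
      κ * Real.exp (r * T) * ((Q x / T + b) / (a * ρ) + ρ) := by
  set P := markovOp K with hP
  have hsucc : ∀ (f : Ω → ℝ) t, (P^[t + 1] f) x = (P^[t] (P f)) x := fun f t => by
    rw [Function.iterate_succ_apply]
  have hYstep : ∀ t, (P^[t + 1] Y) x ≤ (1 + r) * (P^[t] Y) x := fun t => by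
    rw [hsucc]
    refine (iterate_markovOp_mono hK t (g := fun x => (1 + r) * Y x + 0 * Y x)
      (fun x => by simpa using hY x) x).trans ?_
    rw [iterate_markovOp_linear]
    simp [hP]
  have hQstep : ∀ t, (P^[t + 1] Q) x ≤ (P^[t] Q) x - a * (P^[t] (fun x => V x ^ 2)) x + b :=
    fun t => by
    rw [hsucc]
    refine (iterate_markovOp_mono hK t
      (g := fun x => 1 * (fun x => 1 * Q x + -a * V x ^ 2) x + b * (fun _ => 1) x)
      (fun x => by have := hQ x; simp only; linarith) x).trans ?_
    rw [iterate_markovOp_linear, iterate_markovOp_linear, iterate_markovOp_one hK1]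
    simp only [← hP]
    linarith
  have hQsum : ∀ t : ℕ, (P^[t] Q) x ≤
      Q x - a * (∑ s ∈ Finset.range t, (P^[s] (fun x => V x ^ 2)) x) + b * t := by
    intro t
    induction t with
    | zero => simp
    | succ t ih =>
      rw [Finset.sum_range_succ]
      push_cast
      linarith [hQstep t]
  have hQT : 0 ≤ (P^[T] Q) x := by
    have := iterate_markovOp_mono hK T (f := fun x => 0 * Q x + 0 * Q x) (g := Q)
      (fun x => by simpa using hQ0 x) x
    rw [iterate_markovOp_linear] at this
    simpa using this
  have hYpos : ∀ t, 0 ≤ (P^[t] Y) x := fun t => by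
    have := iterate_markovOp_mono hK t (f := fun x => 0 * Q x + 0 * Q x) (g := Y)
      (fun x => by have := hVY x; have := hV0 x; simp; linarith) x
    rw [iterate_markovOp_linear] at this
    simpa using this
  have hYgrow : ∀ s t : ℕ, (P^[t + s] Y) x ≤ (1 + r) ^ s * (P^[t] Y) x := by
    intro s t
    induction s with
    | zero => simp
    | succ s ih =>
      rw [← add_assoc, pow_succ]
      have := mul_le_mul_of_nonneg_left ih (by linarith : 0 ≤ 1 + r)
      linarith [hYstep (t + s)]
  have hexp : ∀ s ∈ Finset.range T, (P^[T] Y) x ≤ Real.exp (r * T) * (P^[s] Y) x := by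
    intro s hs
    have hs' := Finset.mem_range.1 hs
    obtain ⟨t, rfl⟩ := Nat.exists_eq_add_of_lt hs'
    rw [add_assoc]
    refine (hYgrow (t + 1) s).trans (mul_le_mul_of_nonneg_right ?_ (hYpos s))
    calc (1 + r) ^ (t + 1) ≤ (Real.exp r) ^ (t + 1) := by
          gcongr
          linarith [Real.add_one_le_exp r]
      _ = Real.exp (r * (t + 1)) := by
          rw [← Real.exp_nat_mul]; push_cast; ring_nf
      _ ≤ _ := by
          gcongr
          push_cast
          linarith [(Nat.cast_nonneg s : (0:ℝ) ≤ s)]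
  have hYsq : ∀ s, (P^[s] Y) x ≤ κ * ((P^[s] (fun x => V x ^ 2)) x / (2 * ρ) + ρ / 2) := by
    intro s
    refine (iterate_markovOp_mono hK s
      (g := fun x => κ / (2 * ρ) * V x ^ 2 + κ * ρ / 2 * (fun _ => 1) x)
      (fun x => (hYV x).trans ?_) x).trans ?_
    · have : V x ≤ V x ^ 2 / (2 * ρ) + ρ / 2 := by
        rw [div_add_div _ _ (by positivity) (by positivity), le_div_iff₀ (by positivity)]
        nlinarith [sq_nonneg (V x - ρ)]
      calc κ * V x ≤ κ * (V x ^ 2 / (2 * ρ) + ρ / 2) := mul_le_mul_of_nonneg_left this hκ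
        _ = _ := by ring
    · rw [iterate_markovOp_linear K s (fun x => V x ^ 2), iterate_markovOp_one hK1]
      apply le_of_eq
      simp only [← hP]
      ring
  have hVT : (P^[T] V) x ≤ 2 * (P^[T] Y) x := by
    have := iterate_markovOp_mono hK T (f := V) (g := fun x => 2 * Y x + 0 * Y x)
      (fun x => by simpa using hVY x) x
    rw [iterate_markovOp_linear] at this
    simpa using this
  have hT' : (0 : ℝ) < T := by exact_mod_cast hT
  set S := ∑ s ∈ Finset.range T, (P^[s] (fun x => V x ^ 2)) x with hS
  have hsum : T * (P^[T] Y) x ≤ Real.exp (r * T) * (κ * (S / (2 * ρ) + T * (ρ / 2))) := by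
    calc T * (P^[T] Y) x = ∑ s ∈ Finset.range T, (P^[T] Y) x := by simp
      _ ≤ ∑ s ∈ Finset.range T,
          Real.exp (r * T) * (κ * ((P^[s] (fun x => V x ^ 2)) x / (2 * ρ) + ρ / 2)) :=
          Finset.sum_le_sum fun s hs => (hexp s hs).trans
            (mul_le_mul_of_nonneg_left (hYsq s) (Real.exp_nonneg _))
      _ = _ := by
          rw [← Finset.mul_sum, ← Finset.mul_sum, Finset.sum_add_distrib, ← Finset.sum_div]
          simp [hS]
  have hSle : S ≤ (Q x + b * T) / a := by
    rw [le_div_iff₀ ha]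
    linarith [hQsum T]
  have h2 : (P^[T] Y) x ≤ Real.exp (r * T) * (κ * (S / T / (2 * ρ) + ρ / 2)) := by
    refine le_of_mul_le_mul_left ?_ hT'
    refine hsum.trans (le_of_eq ?_)
    field_simp
  have h3 : S / T ≤ (Q x / T + b) / a := by
    rw [div_le_iff₀ hT']
    refine hSle.trans (le_of_eq ?_)
    field_simp
  calc (P^[T] V) x ≤ 2 * (Real.exp (r * T) * (κ * (S / T / (2 * ρ) + ρ / 2))) := by linarith
    _ ≤ 2 * (Real.exp (r * T) * (κ * ((Q x / T + b) / a / (2 * ρ) + ρ / 2))) := by gcongr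
    _ = _ := by field_simp

end MarkovOperator

section Generator

variable {V : Type*} (G : SimpleGraph V)

def adj (u v : V) : ℝ := if G.Adj u v then 1 else 0

def occ (x : V → Bool) (v : V) : ℝ := if x v = true then 1 else 0

def flipDiff (f : (V → Bool) → ℝ) (x : V → Bool) (w : V) : ℝ :=
  f (Function.update x w true) - f (Function.update x w false)

theorem eq_update_self (x : V → Bool) (w : V) :
    (x w = true ∧ x = Function.update x w true) ∨
      (x w = false ∧ x = Function.update x w false) := by
  cases h : x w
  · right; exact ⟨rfl, by rw [← h, Function.update_eq_self]⟩
  · left; exact ⟨rfl, by rw [← h, Function.update_eq_self]⟩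

theorem apply_update_false (f : (V → Bool) → ℝ) (x : V → Bool) (w : V) :
    f (Function.update x w false) = f x - occ x w * flipDiff f x w := by
  rcases eq_update_self x w with ⟨h, h'⟩ | ⟨h, h'⟩
  · simp only [flipDiff, ← h', occ, h]; simp
  · simp only [flipDiff, ← h', occ, h]; simp

theorem flipDiff_add (f g : (V → Bool) → ℝ) (x : V → Bool) (w : V) :
    flipDiff (fun x => f x + g x) x w = flipDiff f x w + flipDiff g x w := by
  simp only [flipDiff]; ring

theorem flipDiff_const_mul (a : ℝ) (f : (V → Bool) → ℝ) (x : V → Bool) (w : V) :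
    flipDiff (fun x => a * f x) x w = a * flipDiff f x w := by
  simp only [flipDiff]; ring

theorem flipDiff_sq (f : (V → Bool) → ℝ) (x : V → Bool) (w : V) :
    flipDiff (fun x => f x ^ 2) x w =
      2 * f x * flipDiff f x w + (1 - 2 * occ x w) * flipDiff f x w ^ 2 := by
  have e1 := apply_update_false f x w
  have e2 : f (Function.update x w true) = f (Function.update x w false) + flipDiff f x w := by
    simp [flipDiff]
  have e3 : flipDiff (fun x => f x ^ 2) x w =
    f (Function.update x w true) ^ 2 - f (Function.update x w false) ^ 2 := rfl
  rw [e3, e2, e1]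
  ring

theorem occ_cases (x : V → Bool) (v : V) : occ x v = 0 ∨ occ x v = 1 := by
  unfold occ; split_ifs <;> simp

theorem occ_mul_self (x : V → Bool) (v : V) : occ x v * occ x v = occ x v := by
  rcases occ_cases x v with h | h <;> simp [h]

theorem occ_nonneg (x : V → Bool) (v : V) : 0 ≤ occ x v := by
  rcases occ_cases x v with h | h <;> simp [h]

theorem occ_le_one (x : V → Bool) (v : V) : occ x v ≤ 1 := by
  rcases occ_cases x v with h | h <;> simp [h]

theorem adj_nonneg (u v : V) : 0 ≤ adj G u v := by
  unfold adj; split_ifs <;> simp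

theorem adj_comm (u v : V) : adj G u v = adj G v u := by
  simp [adj, G.adj_comm]

theorem adj_self (v : V) : adj G v v = 0 := by simp [adj]

def cst (x : V → Bool) (v : V) : ℝ := if ∃ u, G.Adj u v ∧ x u = true then 1 else 0

theorem occ_update (x : V → Bool) (w v : V) (b : Bool) :
    occ (Function.update x w b) v = if v = w then (if b = true then 1 else 0) else occ x v := by
  by_cases h : v = w
  · subst h; simp [occ]
  · simp [occ, h]

theorem flipDiff_occ (x : V → Bool) (w v : V) :
    flipDiff (fun x => occ x v) x w = if v = w then 1 else 0 := by
  simp only [flipDiff, occ_update]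
  split_ifs <;> simp_all

theorem flipDiff_occ_mul_occ (x : V → Bool) (w : V) {u v : V} (h : u ≠ v) :
    flipDiff (fun x => occ x u * occ x v) x w =
      (if u = w then occ x v else 0) + (if v = w then occ x u else 0) := by
  simp only [flipDiff, occ_update]
  split_ifs <;> simp_all

theorem flipDiff_sum {ι : Type*} (s : Finset ι) (f : ι → (V → Bool) → ℝ) (x : V → Bool) (w : V) :
    flipDiff (fun x => ∑ i ∈ s, f i x) x w = ∑ i ∈ s, flipDiff (f i) x w := by
  simp only [flipDiff, Finset.sum_sub_distrib]

variable [Fintype V]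

def nbr (x : V → Bool) (v : V) : ℝ := ∑ u, adj G v u * occ x u

def exc (x : V → Bool) (v : V) : ℝ := max (nbr G x v - 1) 0

def gen (p : ℝ) (f : (V → Bool) → ℝ) (x : V → Bool) : ℝ :=
  ∑ w, cst G x w * (p - occ x w) * flipDiff f x w

theorem sum_agree_off (x : V → Bool) (v : V) (F : (V → Bool) → ℝ) :
    ∑ y : V → Bool, (if ∀ w, w ≠ v → y w = x w then F y else 0) =
      F (Function.update x v true) + F (Function.update x v false) := by
  rw [← Finset.sum_filter]
  have : (Finset.univ.filter fun y : V → Bool => ∀ w, w ≠ v → y w = x w) =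
      {Function.update x v true, Function.update x v false} := by
    ext y
    simp only [Finset.mem_filter, Finset.mem_univ, true_and, Finset.mem_insert,
      Finset.mem_singleton]
    constructor
    · intro h
      cases hy : y v
      · right
        funext w
        by_cases hw : w = v
        · subst hw; simp [hy]
        · simp [hw, h w hw]
      · left
        funext w
        by_cases hw : w = v
        · subst hw; simp [hy]
        · simp [hw, h w hw]
    · rintro (rfl | rfl) w hw <;> simp [hw]
  rw [this, Finset.sum_pair]
  intro h
  have := congrFun h v
  simp at this

theorem markovOp_kcipKernel [Nonempty V] (p : ℝ) (f : (V → Bool) → ℝ) (x : V → Bool) :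
    markovOp (kcipKernel G p) f x = f x + (Fintype.card V : ℝ)⁻¹ * gen G p f x := by
  have hn : (Fintype.card V : ℝ) ≠ 0 := by exact_mod_cast Fintype.card_ne_zero
  have h1 : ∀ v : V, (∑ y : V → Bool, (if ∀ w, w ≠ v → y w = x w then
      (if ∃ u, G.Adj u v ∧ x u = true then (if y v = true then p else 1 - p)
       else (if y v = x v then 1 else 0)) * f y
     else 0)) = f x + cst G x v * (p - occ x v) * flipDiff f x v := by
    intro v
    rw [sum_agree_off]
    have e1 := apply_update_false f x v
    have e2 : f (Function.update x v true) = f x + (1 - occ x v) * flipDiff f x v := by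
      rw [show f (Function.update x v true) = f (Function.update x v false) + flipDiff f x v by
        simp [flipDiff], e1]
      ring
    rw [e1, e2]
    simp only [Function.update_self, if_true, Bool.false_eq_true, if_false]
    unfold cst
    by_cases h : ∃ u, G.Adj u v ∧ x u = true
    · simp only [if_pos h]; ring
    · simp only [if_neg h]
      cases hx : x v <;> simp [occ, hx]
  calc markovOp (kcipKernel G p) f x
      = (Fintype.card V : ℝ)⁻¹ * ∑ v, (∑ y : V → Bool, (if ∀ w, w ≠ v → y w = x w then
      (if ∃ u, G.Adj u v ∧ x u = true then (if y v = true then p else 1 - p)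
       else (if y v = x v then 1 else 0)) * f y
     else 0)) := by
        simp only [markovOp, kcipKernel]
        simp_rw [mul_assoc, ← Finset.mul_sum, Finset.sum_mul]
        rw [Finset.sum_comm]
        simp only [ite_mul, zero_mul]
    _ = _ := by
        rw [Finset.sum_congr rfl fun v _ => h1 v, Finset.sum_add_distrib]
        simp only [Finset.sum_const, Finset.card_univ, nsmul_eq_mul, gen]
        rw [mul_add, inv_mul_cancel_left₀ hn]

theorem kcipKernel_nonneg {p : ℝ} (hp0 : 0 ≤ p) (hp1 : p ≤ 1) (x y : V → Bool) :
    0 ≤ kcipKernel G p x y := by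
  unfold kcipKernel
  refine mul_nonneg (by positivity) (Finset.sum_nonneg fun v _ => ?_)
  split_ifs <;> linarith

theorem sum_kcipKernel [Nonempty V] (p : ℝ) (x : V → Bool) : ∑ y, kcipKernel G p x y = 1 := by
  have := markovOp_kcipKernel G p (fun _ => 1) x
  simpa [markovOp, gen, flipDiff] using this

theorem gen_add (p : ℝ) (f g : (V → Bool) → ℝ) (x : V → Bool) :
    gen G p (fun x => f x + g x) x = gen G p f x + gen G p g x := by
  simp only [gen, flipDiff_add, mul_add, Finset.sum_add_distrib]

theorem gen_const_mul (p a : ℝ) (f : (V → Bool) → ℝ) (x : V → Bool) :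
    gen G p (fun x => a * f x) x = a * gen G p f x := by
  simp only [gen, flipDiff_const_mul, Finset.mul_sum]
  exact Finset.sum_congr rfl fun w _ => by ring

theorem gen_sq (p : ℝ) (f : (V → Bool) → ℝ) (x : V → Bool) :
    gen G p (fun x => f x ^ 2) x = 2 * f x * gen G p f x +
      ∑ w, cst G x w * (p + occ x w - 2 * p * occ x w) * flipDiff f x w ^ 2 := by
  simp only [gen, flipDiff_sq, Finset.mul_sum]
  rw [← Finset.sum_add_distrib]
  refine Finset.sum_congr rfl fun w _ => ?_
  linear_combination (2 * cst G x w * flipDiff f x w ^ 2) * occ_mul_self x w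

theorem nbr_nonneg (x : V → Bool) (v : V) : 0 ≤ nbr G x v :=
  Finset.sum_nonneg fun u _ => mul_nonneg (adj_nonneg G v u) (occ_nonneg x u)

theorem nbr_eq_card (x : V → Bool) (v : V) :
    nbr G x v = ((Finset.univ.filter fun u => G.Adj u v ∧ x u = true).card : ℝ) := by
  simp only [nbr, adj, occ, Finset.card_filter]
  push_cast
  refine Finset.sum_congr rfl fun u _ => ?_
  rw [G.adj_comm]
  split_ifs <;> simp_all

theorem nbr_cases (x : V → Bool) (v : V) :
    (nbr G x v = 0 ∧ cst G x v = 0 ∧ exc G x v = 0) ∨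
      (nbr G x v = 1 ∧ cst G x v = 1 ∧ exc G x v = 0) ∨
      (2 ≤ nbr G x v ∧ cst G x v = 1 ∧ exc G x v = nbr G x v - 1) := by
  have hc : cst G x v = if nbr G x v = 0 then 0 else 1 := by
    unfold cst
    rw [nbr_eq_card]
    simp only [Nat.cast_eq_zero, Finset.card_eq_zero, Finset.filter_eq_empty_iff,
      Finset.mem_univ, true_implies]
    split_ifs with h1 h2 h2
    · obtain ⟨u, hu⟩ := h1; exact absurd hu (h2 (x := u))
    · rfl
    · rfl
    · push Not at h2; exact absurd h2 h1
  rw [hc, exc]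
  obtain ⟨k, hk⟩ : ∃ k : ℕ, nbr G x v = k := ⟨_, nbr_eq_card G x v⟩
  rw [hk]
  rcases k with _ | _ | k
  · left; simp
  · right; left; simp
  · right; right
    push_cast
    have : (0 : ℝ) ≤ k := Nat.cast_nonneg k
    refine ⟨by linarith, ?_, ?_⟩
    · rw [if_neg]; linarith
    · rw [max_eq_left]; linarith

theorem cst_eq (x : V → Bool) (v : V) : cst G x v = nbr G x v - exc G x v := by
  rcases nbr_cases G x v with ⟨h1, h2, h3⟩ | ⟨h1, h2, h3⟩ | ⟨h1, h2, h3⟩ <;> rw [h2, h3] <;>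
    linarith

theorem exc_nonneg (x : V → Bool) (v : V) : 0 ≤ exc G x v := le_max_right _ _

theorem exc_le_nbr (x : V → Bool) (v : V) : exc G x v ≤ nbr G x v := by
  rcases nbr_cases G x v with ⟨h1, h2, h3⟩ | ⟨h1, h2, h3⟩ | ⟨h1, h2, h3⟩ <;> linarith

theorem cst_mul_of_adj_sum (x : V → Bool) (w : V) (t : V → ℝ) (ht : ∀ u, ¬ G.Adj w u → t u = 0) :
    cst G x w * ∑ u, t u * occ x u = ∑ u, t u * occ x u := by
  unfold cst
  split_ifs with h
  · simp
  · rw [zero_mul, eq_comm]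
    refine Finset.sum_eq_zero fun u _ => ?_
    by_cases hu : G.Adj w u
    · have : x u ≠ true := fun hx => h ⟨u, hu.symm, hx⟩
      simp [occ, this]
    · simp [ht u hu]

theorem cst_mul_nbr (x : V → Bool) (w : V) : cst G x w * nbr G x w = nbr G x w :=
  cst_mul_of_adj_sum G x w _ fun u hu => by simp [adj, hu]

theorem cst_mul_exc (x : V → Bool) (w : V) : cst G x w * exc G x w = exc G x w := by
  rcases nbr_cases G x w with ⟨h1, h2, h3⟩ | ⟨h1, h2, h3⟩ | ⟨h1, h2, h3⟩ <;> rw [h2, h3] <;> ring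

theorem flipDiff_nbr (x : V → Bool) (w v : V) :
    flipDiff (fun x => nbr G x v) x w = adj G v w := by
  unfold nbr
  rw [flipDiff_sum]
  simp only [flipDiff_const_mul, flipDiff_occ]
  simp

/-- The number of particles, as a sum of indicators. -/
def mass (x : V → Bool) : ℝ := ∑ v, occ x v

theorem numParticles_eq_mass (x : V → Bool) : (numParticles x : ℝ) = mass x := by
  simp only [numParticles, mass, occ, Finset.sum_boole]

/-- The pair functional with weights `t`, each unordered pair being counted once. -/
def pairSum (t : V → V → ℝ) (x : V → Bool) : ℝ :=
  (1 / 2) * ∑ u, ∑ v, t u v * (occ x u * occ x v)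

/-- The sum of the excesses over all vertices. -/
def excSum (x : V → Bool) : ℝ := ∑ v, exc G x v

/-- The sum of the excesses over the occupied vertices. -/
def occExcSum (x : V → Bool) : ℝ := ∑ v, occ x v * exc G x v

/-- The change of `occExcSum` due to the neighbours of a flipped vertex. -/
def spread (x : V → Bool) (w : V) : ℝ :=
  ∑ u, (adj G w u * if 1 ≤ nbr G x u - occ x w then 1 else 0) * occ x u

theorem flipDiff_mass (x : V → Bool) (w : V) : flipDiff mass x w = 1 := by
  have : (mass : (V → Bool) → ℝ) = fun x => ∑ v, occ x v := rfl
  rw [this, flipDiff_sum]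
  simp [flipDiff_occ]

theorem flipDiff_pairSum {t : V → V → ℝ} (ht : ∀ u v, t u v = t v u) (ht0 : ∀ v, t v v = 0)
    (x : V → Bool) (w : V) : flipDiff (pairSum t) x w = ∑ u, t w u * occ x u := by
  have : pairSum t = fun x => (1 / 2) * ∑ u, ∑ v, t u v * (occ x u * occ x v) := rfl
  rw [this, flipDiff_const_mul, flipDiff_sum]
  have h1 : ∀ u v, flipDiff (fun x => t u v * (occ x u * occ x v)) x w =
      (if u = w then t u v * occ x v else 0) + (if v = w then t u v * occ x u else 0) := by
    intro u v
    rw [flipDiff_const_mul]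
    by_cases h : u = v
    · subst h; simp [ht0]
    · rw [flipDiff_occ_mul_occ x w h, mul_add]
      split_ifs <;> simp
  simp only [flipDiff_sum, h1, Finset.sum_add_distrib]
  rw [Finset.sum_comm (f := fun u v => if u = w then t u v * occ x v else 0)]
  simp only [Finset.sum_ite_eq', Finset.mem_univ, if_true]
  rw [Finset.sum_congr rfl fun u _ => (by rw [ht u w] : t u w * occ x u = t w u * occ x u)]
  ring

theorem two_mul_pairSum (t : V → V → ℝ) (x : V → Bool) :
    2 * pairSum t x = ∑ w, occ x w * ∑ u, t w u * occ x u := by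
  unfold pairSum
  simp only [Finset.mul_sum]
  refine Finset.sum_congr rfl fun w _ => Finset.sum_congr rfl fun u _ => by ring

theorem gen_pairSum {t : V → V → ℝ} (ht : ∀ u v, t u v = t v u)
    (htG : ∀ u v, ¬ G.Adj u v → t u v = 0) (p : ℝ) (x : V → Bool) :
    gen G p (pairSum t) x = p * ∑ u, occ x u * ∑ w, t w u - 2 * pairSum t x := by
  unfold gen
  have h : ∀ w, cst G x w * (p - occ x w) * flipDiff (pairSum t) x w =
      p * (∑ u, t w u * occ x u) - occ x w * ∑ u, t w u * occ x u := by
    intro w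
    rw [flipDiff_pairSum ht (fun v => htG v v (G.loopless.irrefl v))]
    linear_combination (p - occ x w) * cst_mul_of_adj_sum G x w (t w) (htG w)
  rw [Finset.sum_congr rfl fun w _ => h w, Finset.sum_sub_distrib, two_mul_pairSum,
    ← Finset.mul_sum, Finset.sum_comm]
  congr 2
  refine Finset.sum_congr rfl fun u _ => ?_
  rw [Finset.mul_sum]
  exact Finset.sum_congr rfl fun w _ => mul_comm _ _

/-- The number of edges between particles. -/
def edgeSum (x : V → Bool) : ℝ := pairSum (adj G) x

theorem two_mul_edgeSum (x : V → Bool) : 2 * edgeSum G x = ∑ v, occ x v * nbr G x v :=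
  two_mul_pairSum _ x

theorem edgeSum_nonneg (x : V → Bool) : 0 ≤ edgeSum G x := by
  have := two_mul_edgeSum G x
  have h : 0 ≤ ∑ v, occ x v * nbr G x v :=
    Finset.sum_nonneg fun v _ => mul_nonneg (occ_nonneg x v) (nbr_nonneg G x v)
  linarith

theorem mass_nonneg (x : V → Bool) : 0 ≤ mass x :=
  Finset.sum_nonneg fun v _ => occ_nonneg x v

theorem excSum_nonneg (x : V → Bool) : 0 ≤ excSum G x :=
  Finset.sum_nonneg fun v _ => exc_nonneg G x v

theorem occExcSum_nonneg (x : V → Bool) : 0 ≤ occExcSum G x :=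
  Finset.sum_nonneg fun v _ => mul_nonneg (occ_nonneg x v) (exc_nonneg G x v)

theorem flipDiff_edgeSum (x : V → Bool) (w : V) : flipDiff (edgeSum G) x w = nbr G x w :=
  flipDiff_pairSum (adj_comm G) (adj_self G) x w

theorem flipDiff_occExcSum (x : V → Bool) (w : V) :
    flipDiff (occExcSum G) x w = exc G x w + spread G x w := by
  have h1 : ∀ v, flipDiff (fun x => occ x v * exc G x v) x w = (if v = w then exc G x v else 0) +
      (adj G w v * if 1 ≤ nbr G x v - occ x w then 1 else 0) * occ x v := by
    intro v
    have n0 : nbr G (Function.update x w false) v = nbr G x v - occ x w * adj G v w := by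
      rw [← flipDiff_nbr G x w v]
      exact apply_update_false (fun x => nbr G x v) x w
    have n1 : nbr G (Function.update x w true) v =
        nbr G (Function.update x w false) v + adj G v w := by
      rw [← flipDiff_nbr G x w v]
      simp [flipDiff]
    have e0 : flipDiff (fun x => occ x v * exc G x v) x w =
        occ (Function.update x w true) v * exc G (Function.update x w true) v -
        occ (Function.update x w false) v * exc G (Function.update x w false) v := rfl
    rw [e0]
    by_cases h : v = w
    · subst h
      simp [occ_update, adj_self, exc, n1, n0]
    · simp only [occ_update, if_neg h, zero_add]
      by_cases ha : G.Adj v w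
      · have ha1 : adj G v w = 1 := by simp [adj, ha]
        rw [adj_comm G w v, ha1, one_mul]
        have hx : exc G (Function.update x w true) v - exc G (Function.update x w false) v =
            if 1 ≤ nbr G x v - occ x w then 1 else 0 := by
          rw [ha1, mul_one] at n0
          rw [← n0]
          unfold exc
          rw [n1, ha1, add_sub_cancel_right, max_eq_left (nbr_nonneg _ _ _)]
          change _ - exc G (Function.update x w false) v = _
          rcases nbr_cases G (Function.update x w false) v with ⟨h1, h2, h3⟩ | ⟨h1, h2, h3⟩ |
              ⟨h1, h2, h3⟩
          · rw [h1, h3]; norm_num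
          · rw [h1, h3]; norm_num
          · rw [if_pos (by linarith), h3]; ring
        rw [← hx]; ring
      · have ha0 : adj G v w = 0 := by simp [adj, ha]
        rw [adj_comm G w v]
        simp [exc, n1, n0, ha0]
  have : occExcSum G = fun x => ∑ v, occ x v * exc G x v := rfl
  rw [this, flipDiff_sum, Finset.sum_congr rfl fun v _ => h1 v, Finset.sum_add_distrib]
  simp [spread]

theorem spread_nonneg (x : V → Bool) (w : V) : 0 ≤ spread G x w :=
  Finset.sum_nonneg fun u _ => mul_nonneg (mul_nonneg (adj_nonneg G w u)
    (by split_ifs <;> simp)) (occ_nonneg x u)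

theorem spread_le_nbr (x : V → Bool) (w : V) : spread G x w ≤ nbr G x w := by
  refine Finset.sum_le_sum fun u _ => mul_le_mul_of_nonneg_right ?_ (occ_nonneg x u)
  split_ifs <;> simp [adj_nonneg]

theorem cst_mul_spread (x : V → Bool) (w : V) : cst G x w * spread G x w = spread G x w :=
  cst_mul_of_adj_sum G x w _ fun u hu => by simp [adj, hu]

theorem sum_nbr_mul (x : V → Bool) (f : V → ℝ) :
    ∑ w, f w * nbr G x w = ∑ u, occ x u * ∑ w, adj G w u * f w := by
  simp only [nbr, Finset.mul_sum]
  rw [Finset.sum_comm]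
  exact Finset.sum_congr rfl fun u _ => Finset.sum_congr rfl fun w _ => by ring

theorem occ_mul_spread_sum (x : V → Bool) :
    ∑ w, occ x w * spread G x w =
      ∑ u, occ x u * (nbr G x u * if 1 ≤ nbr G x u - 1 then 1 else 0) := by
  simp only [spread, Finset.mul_sum]
  rw [Finset.sum_comm]
  refine Finset.sum_congr rfl fun u _ => ?_
  rw [nbr.eq_def G x u, Finset.sum_mul, Finset.mul_sum]
  refine Finset.sum_congr rfl fun w _ => ?_
  rw [← nbr.eq_def G x u, adj_comm G w u]
  rcases occ_cases x w with h | h <;> rw [h] <;> ring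

theorem occExcSum_le (x : V → Bool) : occExcSum G x ≤ ∑ w, occ x w * spread G x w := by
  rw [occ_mul_spread_sum]
  refine Finset.sum_le_sum fun u _ => mul_le_mul_of_nonneg_left ?_ (occ_nonneg x u)
  rcases nbr_cases G x u with ⟨h1, h2, h3⟩ | ⟨h1, h2, h3⟩ | ⟨h1, h2, h3⟩
  · rw [h1, h3]; norm_num
  · rw [h1, h3]; norm_num
  · rw [h3, if_pos (by linarith)]; linarith

theorem occ_mul_spread_le (x : V → Bool) :
    ∑ w, occ x w * spread G x w ≤ 2 * occExcSum G x := by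
  rw [occ_mul_spread_sum, occExcSum, Finset.mul_sum]
  refine Finset.sum_le_sum fun u _ => ?_
  rw [mul_left_comm 2]
  refine mul_le_mul_of_nonneg_left ?_ (occ_nonneg x u)
  rcases nbr_cases G x u with ⟨h1, h2, h3⟩ | ⟨h1, h2, h3⟩ | ⟨h1, h2, h3⟩
  · rw [h1, h3]; norm_num
  · rw [h1, h3]; norm_num
  · rw [h3, if_pos (by linarith)]; linarith

variable {G} {D : ℝ}

theorem sum_nbr_le (hD : ∀ u, ∑ w, adj G w u ≤ D) (x : V → Bool) :
    ∑ w, nbr G x w ≤ D * mass x := by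
  have := sum_nbr_mul G x (fun _ => 1)
  simp only [one_mul, mul_one] at this
  rw [this, mass, Finset.mul_sum]
  refine Finset.sum_le_sum fun u _ => ?_
  rw [mul_comm]
  exact mul_le_mul_of_nonneg_right (hD u) (occ_nonneg x u)

theorem nbr_le (hD : ∀ u, ∑ w, adj G w u ≤ D) (x : V → Bool) (v : V) : nbr G x v ≤ D := by
  refine le_trans ?_ (hD v)
  refine Finset.sum_le_sum fun u _ => ?_
  rw [adj_comm]
  exact mul_le_of_le_one_right (adj_nonneg G u v) (occ_le_one x u)

theorem sum_spread_le (hD : ∀ u, ∑ w, adj G w u ≤ D) (x : V → Bool) :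
    ∑ w, spread G x w ≤ 2 * D * edgeSum G x := by
  calc ∑ w, spread G x w
      ≤ ∑ w, ∑ u, adj G w u * (occ x u * nbr G x u) := by
        refine Finset.sum_le_sum fun w _ => Finset.sum_le_sum fun u _ => ?_
        rw [mul_assoc, mul_comm _ (occ x u)]
        refine mul_le_mul_of_nonneg_left (mul_le_mul_of_nonneg_left ?_ (occ_nonneg x u))
          (adj_nonneg G w u)
        split_ifs with h
        · linarith [occ_nonneg x w]
        · exact nbr_nonneg G x u
    _ = ∑ u, (∑ w, adj G w u) * (occ x u * nbr G x u) := by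
        rw [Finset.sum_comm]
        simp only [Finset.sum_mul]
    _ ≤ ∑ u, D * (occ x u * nbr G x u) := Finset.sum_le_sum fun u _ =>
        mul_le_mul_of_nonneg_right (hD u) (mul_nonneg (occ_nonneg x u) (nbr_nonneg G x u))
    _ = _ := by rw [← Finset.mul_sum, ← two_mul_edgeSum]; ring

theorem two_mul_edgeSum_le (hD : ∀ u, ∑ w, adj G w u ≤ D) (x : V → Bool) :
    2 * edgeSum G x ≤ D * mass x := by
  rw [two_mul_edgeSum, mass, Finset.mul_sum]
  refine Finset.sum_le_sum fun u _ => ?_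
  rw [mul_comm]
  exact mul_le_mul_of_nonneg_right (nbr_le hD x u) (occ_nonneg x u)

/-- The corrected particle count: a linear Lyapunov function. -/
def corrMass (G : SimpleGraph V) (p D : ℝ) (x : V → Bool) : ℝ :=
  mass x + ((p * D - 1) * edgeSum G x + 3 / 4 * occExcSum G x)

/-- The instantaneous coalescence rate, up to constants. -/
def coalRate (G : SimpleGraph V) (p : ℝ) (x : V → Bool) : ℝ :=
  p * excSum G x + occExcSum G x

theorem coalRate_nonneg {p : ℝ} (hp : 0 ≤ p) (x : V → Bool) : 0 ≤ coalRate G p x :=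
  add_nonneg (mul_nonneg hp (excSum_nonneg G x)) (occExcSum_nonneg G x)

theorem sum_exc_mul (p : ℝ) (x : V → Bool) :
    ∑ w, (p + occ x w) * exc G x w = coalRate G p x := by
  simp only [coalRate, excSum, occExcSum, add_mul, Finset.sum_add_distrib, Finset.mul_sum]

theorem corrMass_eq (p D : ℝ) (x : V → Bool) : corrMass G p D x =
    ∑ v, occ x v * (1 + (p * D - 1) / 2 * nbr G x v + 3 / 4 * exc G x v) := by
  have h : edgeSum G x = (1 / 2) * ∑ v, occ x v * nbr G x v := by
    rw [← two_mul_edgeSum]; ring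
  rw [corrMass, h, mass, occExcSum, Finset.mul_sum, Finset.mul_sum, Finset.mul_sum,
    ← Finset.sum_add_distrib, ← Finset.sum_add_distrib]
  exact Finset.sum_congr rfl fun v _ => by ring

theorem mass_le_corrMass {p : ℝ} (hp : 0 ≤ p) (hD1 : 1 ≤ D) (x : V → Bool) :
    mass x ≤ 2 * corrMass G p D x := by
  rw [corrMass_eq, mass, Finset.mul_sum]
  refine Finset.sum_le_sum fun v _ => ?_
  rw [mul_left_comm]
  refine le_mul_of_one_le_right (occ_nonneg x v) ?_
  have h : 0 ≤ p * D * nbr G x v :=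
    mul_nonneg (mul_nonneg hp (by linarith)) (nbr_nonneg G x v)
  rcases nbr_cases G x v with ⟨h1, h2, h3⟩ | ⟨h1, h2, h3⟩ | ⟨h1, h2, h3⟩
  · rw [h1, h3]; norm_num
  · rw [h1] at h
    rw [h1, h3]; linarith
  · rw [h3]; linarith

theorem corrMass_le {p : ℝ} (hp1 : p ≤ 1) (hD1 : 1 ≤ D)
    (hD : ∀ u, ∑ w, adj G w u ≤ D) (x : V → Bool) :
    corrMass G p D x ≤ 3 * D ^ 2 * mass x := by
  rw [corrMass_eq, mass, Finset.mul_sum]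
  refine Finset.sum_le_sum fun v _ => ?_
  rw [mul_comm (3 * D ^ 2)]
  refine mul_le_mul_of_nonneg_left ?_ (occ_nonneg x v)
  have h0 := nbr_nonneg G x v
  have h1 := nbr_le hD x v
  have h2 := exc_le_nbr G x v
  have h3 : p * D * nbr G x v ≤ D * D := by
    refine mul_le_mul ?_ h1 h0 (by linarith)
    nlinarith
  nlinarith

theorem flipDiff_corrMass (p : ℝ) (x : V → Bool) (w : V) :
    flipDiff (corrMass G p D) x w =
      1 + (p * D - 1) * nbr G x w + 3 / 4 * (exc G x w + spread G x w) := by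
  have : corrMass G p D =
      fun x => mass x + ((p * D - 1) * edgeSum G x + 3 / 4 * occExcSum G x) := rfl
  rw [this, flipDiff_add, flipDiff_add, flipDiff_const_mul, flipDiff_const_mul, flipDiff_mass,
    flipDiff_edgeSum, flipDiff_occExcSum]
  ring

theorem cst_mul_flipDiff_corrMass (p : ℝ) (x : V → Bool) (w : V) :
    cst G x w * flipDiff (corrMass G p D) x w =
      -(1 / 4) * exc G x w + p * D * nbr G x w + 3 / 4 * spread G x w := by
  rw [flipDiff_corrMass]
  linear_combination cst_eq G x w + (p * D - 1) * cst_mul_nbr G x w +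
    3 / 4 * cst_mul_exc G x w + 3 / 4 * cst_mul_spread G x w

theorem gen_corrMass_le {p : ℝ} (hp : 0 ≤ p) (hD1 : 1 ≤ D) (hD : ∀ u, ∑ w, adj G w u ≤ D)
    (x : V → Bool) :
    gen G p (corrMass G p D) x ≤
      -(1 / 4) * coalRate G p x - 1 / 2 * D * (p * edgeSum G x) + D ^ 2 * p ^ 2 * mass x := by
  have h : gen G p (corrMass G p D) x =
      -(1 / 4) * (p * excSum G x - occExcSum G x) +
        p * D * (p * ∑ w, nbr G x w - 2 * edgeSum G x) +
        3 / 4 * (p * ∑ w, spread G x w - ∑ w, occ x w * spread G x w) := by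
    rw [two_mul_edgeSum, excSum, occExcSum]
    simp only [gen, Finset.mul_sum, ← Finset.sum_sub_distrib, ← Finset.sum_add_distrib]
    refine Finset.sum_congr rfl fun w _ => ?_
    linear_combination (p - occ x w) * cst_mul_flipDiff_corrMass (D := D) p x w
  have h1 := mul_le_mul_of_nonneg_left (sum_nbr_le hD x)
    (mul_nonneg (mul_nonneg hp (by linarith : 0 ≤ D)) hp)
  have h2 := mul_le_mul_of_nonneg_left (sum_spread_le hD x) hp
  have h3 := occExcSum_le G x
  have h4 := occExcSum_nonneg G x
  rw [h, coalRate]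
  linarith

theorem gen_corrMass_sq_le {p : ℝ} (hp : 0 ≤ p) (hp1 : p ≤ 1) (hD1 : 1 ≤ D)
    (hD : ∀ u, ∑ w, adj G w u ≤ D) (x : V → Bool) :
    gen G p (fun x => corrMass G p D x ^ 2) x ≤
      -(1 / 4) * mass x * coalRate G p x + 6 * D ^ 4 * p ^ 2 * mass x ^ 2 +
        9 * D * coalRate G p x + 12 * D ^ 3 * (p * edgeSum G x) + 3 * D ^ 4 * p ^ 3 * mass x := by
  have hsq : ∀ w, cst G x w * (p + occ x w - 2 * p * occ x w) *
      flipDiff (corrMass G p D) x w ^ 2 ≤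
      3 * D * ((p + occ x w) * exc G x w) + 3 * D * (p * spread G x w + occ x w * spread G x w) +
        3 * p ^ 2 * D ^ 3 * (p * nbr G x w + occ x w * nbr G x w) := by
    intro w
    have he := exc_nonneg G x w
    have hs := spread_nonneg G x w
    have hn := nbr_nonneg G x w
    have hnD := nbr_le hD x w
    have heD := (exc_le_nbr G x w).trans hnD
    have hsD := (spread_le_nbr G x w).trans hnD
    have ho := occ_nonneg x w
    have ho1 := occ_le_one x w
    have hc : cst G x w * cst G x w = cst G x w := by
      unfold cst; split_ifs <;> simp
    have e1 : cst G x w * flipDiff (corrMass G p D) x w ^ 2 =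
        (-(1 / 4) * exc G x w + p * D * nbr G x w + 3 / 4 * spread G x w) ^ 2 := by
      rw [← cst_mul_flipDiff_corrMass]
      linear_combination -(flipDiff (corrMass G p D) x w ^ 2) * hc
    have e2 : (-(1 / 4) * exc G x w + p * D * nbr G x w + 3 / 4 * spread G x w) ^ 2 ≤
        3 * (exc G x w ^ 2 + (p * D * nbr G x w) ^ 2 + spread G x w ^ 2) := by
      nlinarith [sq_nonneg (-(1 / 4) * exc G x w - p * D * nbr G x w),
        sq_nonneg (-(1 / 4) * exc G x w - 3 / 4 * spread G x w),
        sq_nonneg (p * D * nbr G x w - 3 / 4 * spread G x w),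
        sq_nonneg (exc G x w), sq_nonneg (spread G x w)]
    have e3 : exc G x w ^ 2 ≤ D * exc G x w := by nlinarith
    have e4 : spread G x w ^ 2 ≤ D * spread G x w := by nlinarith
    have e5 : (p * D * nbr G x w) ^ 2 ≤ p ^ 2 * D ^ 3 * nbr G x w := by
      have : nbr G x w ^ 2 ≤ D * nbr G x w := by nlinarith
      calc (p * D * nbr G x w) ^ 2 = p ^ 2 * D ^ 2 * nbr G x w ^ 2 := by ring
        _ ≤ p ^ 2 * D ^ 2 * (D * nbr G x w) := by gcongr
        _ = _ := by ring
    calc cst G x w * (p + occ x w - 2 * p * occ x w) * flipDiff (corrMass G p D) x w ^ 2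
        = (p + occ x w - 2 * p * occ x w) *
          (cst G x w * flipDiff (corrMass G p D) x w ^ 2) := by ring
      _ ≤ (p + occ x w) * (3 * (D * exc G x w + p ^ 2 * D ^ 3 * nbr G x w +
            D * spread G x w)) := by
          rw [e1]
          refine mul_le_mul ?_ ?_ (sq_nonneg _) (by linarith)
          · nlinarith [mul_nonneg hp ho]
          · linarith
      _ = _ := by ring
  have hsum : ∑ w, cst G x w * (p + occ x w - 2 * p * occ x w) *
      flipDiff (corrMass G p D) x w ^ 2 ≤
      3 * D * coalRate G p x +
        3 * D * (p * ∑ w, spread G x w + ∑ w, occ x w * spread G x w) +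
        3 * p ^ 2 * D ^ 3 * (p * ∑ w, nbr G x w + 2 * edgeSum G x) := by
    refine (Finset.sum_le_sum fun w _ => hsq w).trans (le_of_eq ?_)
    rw [two_mul_edgeSum, ← sum_exc_mul]
    simp only [Finset.mul_sum, ← Finset.sum_add_distrib]
  have hD0 : 0 ≤ D := by linarith
  have hE := edgeSum_nonneg G x
  have hm := mass_nonneg x
  have hpE : 0 ≤ p * edgeSum G x := mul_nonneg hp hE
  have hR := coalRate_nonneg (G := G) hp x
  have hY := mass_le_corrMass (G := G) (D := D) hp hD1 x
  have hY2 := corrMass_le hp1 hD1 hD x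
  have hK : occExcSum G x ≤ coalRate G p x := by
    have := mul_nonneg hp (excSum_nonneg G x)
    unfold coalRate; linarith
  have hdrift : 2 * corrMass G p D x * gen G p (corrMass G p D) x ≤
      -(1 / 4) * mass x * coalRate G p x + 6 * D ^ 4 * p ^ 2 * mass x ^ 2 := by
    have hY0 : 0 ≤ 2 * corrMass G p D x := hm.trans hY
    have a1 := mul_le_mul_of_nonneg_left (gen_corrMass_le hp hD1 hD x) hY0
    have a2 : 0 ≤ 2 * corrMass G p D x * (1 / 2 * D * (p * edgeSum G x)) := by positivity
    have a3 := mul_le_mul_of_nonneg_right hY (by positivity : 0 ≤ 1 / 4 * coalRate G p x)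
    have a4 := mul_le_mul_of_nonneg_right hY2 (by positivity : 0 ≤ 2 * (D ^ 2 * p ^ 2 * mass x))
    linarith
  rw [gen_sq]
  have b1 : 3 * D * (p * ∑ w, spread G x w + ∑ w, occ x w * spread G x w) ≤
      3 * D * (2 * D * (p * edgeSum G x) + 2 * coalRate G p x) := by
    have := mul_le_mul_of_nonneg_left (sum_spread_le hD x) hp
    have := occ_mul_spread_le G x
    refine mul_le_mul_of_nonneg_left ?_ (by positivity)
    linarith
  have b2 : 3 * p ^ 2 * D ^ 3 * (p * ∑ w, nbr G x w + 2 * edgeSum G x) ≤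
      3 * D ^ 4 * p ^ 3 * mass x + 6 * D ^ 3 * (p * edgeSum G x) := by
    have := mul_le_mul_of_nonneg_left (sum_nbr_le hD x)
      (by positivity : 0 ≤ 3 * p ^ 2 * D ^ 3 * p)
    have : p ^ 2 * edgeSum G x ≤ p * edgeSum G x := by nlinarith
    have := mul_le_mul_of_nonneg_left this (by positivity : 0 ≤ 6 * D ^ 3)
    linarith
  have b3 : 6 * D * D * (p * edgeSum G x) ≤ 6 * D ^ 3 * (p * edgeSum G x) := by
    refine mul_le_mul_of_nonneg_right ?_ hpE
    nlinarith [mul_nonneg hD0 hD0]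
  linarith

/-- A symmetric nonnegative kernel `g` whose graph Laplacian is, up to the factor `κ`, the
difference between the stochastic kernel `b` and the identity. The potential under `g` of any
configuration of `m` particles is at most `δ * m + C`. -/
structure IsGreenKernel (G : SimpleGraph V) (g b : V → V → ℝ) (D κ M δ C β : ℝ) : Prop where
  degree_le : ∀ u, ∑ w, adj G w u ≤ D
  symm : ∀ u v, g u v = g v u
  nonneg : ∀ u v, 0 ≤ g u v
  le : ∀ u v, g u v ≤ M
  diag : ∀ u v, g u u = g v v
  laplacian : ∀ u v, ∑ w, adj G w u * (g w v - g u v) = κ * (b u v - if u = v then 1 else 0)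
  kernel_nonneg : ∀ u v, 0 ≤ b u v
  kernel_symm : ∀ u v, b u v = b v u
  kernel_sum : ∀ u, ∑ v, b u v = 1
  kernel_diag_le : ∀ u, b u u ≤ β
  kernel_form_ge : ∀ x : V → Bool,
    mass x ^ 2 / Fintype.card V ≤ ∑ u, occ x u * ∑ v, b u v * occ x v
  potential_le : ∀ (x : V → Bool) u, ∑ v, g u v * occ x v ≤ δ * mass x + C

omit [Fintype V] in
theorem flipDiff_mul (f h : (V → Bool) → ℝ) (x : V → Bool) (w : V) :
    flipDiff (fun x => f x * h x) x w = f x * flipDiff h x w + h x * flipDiff f x w +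
      (1 - 2 * occ x w) * (flipDiff f x w * flipDiff h x w) := by
  have e1 := apply_update_false f x w
  have e1' := apply_update_false h x w
  have e2 : f (Function.update x w true) = f (Function.update x w false) + flipDiff f x w := by
    simp [flipDiff]
  have e2' : h (Function.update x w true) = h (Function.update x w false) + flipDiff h x w := by
    simp [flipDiff]
  have e3 : flipDiff (fun x => f x * h x) x w =
    f (Function.update x w true) * h (Function.update x w true) -
      f (Function.update x w false) * h (Function.update x w false) := rfl
  rw [e3, e2, e2', e1, e1']
  ring

/-- A particle weighted by one minus half the number of neighbouring particles. -/
def charge (G : SimpleGraph V) (x : V → Bool) (v : V) : ℝ := occ x v * (1 - nbr G x v / 2)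

/-- The potential of the charges under the kernel `g`. -/
def potential (G : SimpleGraph V) (g : V → V → ℝ) (x : V → Bool) (v : V) : ℝ :=
  ∑ u, g v u * charge G x u

/-- The energy of the charges under the kernel `g`. -/
def energy (G : SimpleGraph V) (g : V → V → ℝ) (x : V → Bool) : ℝ :=
  ∑ v, charge G x v * potential G g x v

/-- The change of the charge at `v` when `w` is flipped. -/
def chargeDiff (G : SimpleGraph V) (x : V → Bool) (w v : V) : ℝ :=
  (if v = w then 1 - nbr G x w / 2 else 0) - adj G w v * occ x v / 2

theorem flipDiff_charge (x : V → Bool) (w v : V) :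
    flipDiff (fun x => charge G x v) x w = chargeDiff G x w v := by
  have h1 : flipDiff (fun x => 1 - nbr G x v / 2) x w = - (adj G w v / 2) := by
    rw [adj_comm, ← flipDiff_nbr G x w v]
    simp only [flipDiff]; ring
  unfold charge chargeDiff
  rw [flipDiff_mul, flipDiff_occ, h1]
  by_cases h : v = w
  · subst h; simp [adj_self]
  · simp [h]; ring

theorem flipDiff_energy {g : V → V → ℝ} (hg : ∀ u v, g u v = g v u) (x : V → Bool) (w : V) :
    flipDiff (energy G g) x w = 2 * ∑ v, chargeDiff G x w v * potential G g x v +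
      (1 - 2 * occ x w) * ∑ v, chargeDiff G x w v * ∑ u, g v u * chargeDiff G x w u := by
  have e : energy G g = fun x => ∑ v, charge G x v * potential G g x v := rfl
  have hp : ∀ v, flipDiff (fun x => potential G g x v) x w = ∑ u, g v u * chargeDiff G x w u := by
    intro v
    unfold potential
    rw [flipDiff_sum]
    simp only [flipDiff_const_mul, flipDiff_charge]
  have hs : ∑ v, charge G x v * ∑ u, g v u * chargeDiff G x w u =
      ∑ v, chargeDiff G x w v * potential G g x v := by
    simp only [potential, Finset.mul_sum]
    rw [Finset.sum_comm]
    refine Finset.sum_congr rfl fun u _ => Finset.sum_congr rfl fun v _ => ?_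
    rw [hg]; ring
  rw [e, flipDiff_sum]
  simp only [flipDiff_mul, flipDiff_charge, hp, Finset.sum_add_distrib, hs, ← Finset.mul_sum]
  rw [Finset.sum_congr rfl fun v _ => mul_comm (potential G g x v) _]
  ring

theorem cst_mul_chargeDiff_sum (x : V → Bool) (w : V) (ψ : V → ℝ) :
    cst G x w * (2 * ∑ v, chargeDiff G x w v * ψ v) =
      -2 * (exc G x w * ψ w) + ∑ u, adj G w u * occ x u * (ψ w - ψ u) := by
  have h1 : ∑ v, chargeDiff G x w v * ψ v =
      (1 - nbr G x w / 2) * ψ w - (∑ u, (adj G w u * ψ u) * occ x u) / 2 := by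
    simp only [chargeDiff, sub_mul, Finset.sum_sub_distrib, ite_mul, zero_mul,
      Finset.sum_ite_eq', Finset.mem_univ, if_true]
    rw [Finset.sum_div]
    congr 1
    exact Finset.sum_congr rfl fun u _ => by ring
  have h2 : ∑ u, adj G w u * occ x u * (ψ w - ψ u) =
      nbr G x w * ψ w - ∑ u, (adj G w u * ψ u) * occ x u := by
    rw [nbr, Finset.sum_mul, ← Finset.sum_sub_distrib]
    exact Finset.sum_congr rfl fun u _ => by ring
  have h3 := cst_mul_of_adj_sum G x w (fun u => adj G w u * ψ u) fun u hu => by simp [adj, hu]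
  have h4 := cst_mul_nbr G x w
  have h5 := cst_eq G x w
  rw [h1, h2]
  linear_combination -h3 + 2 * ψ w * h5 - ψ w * h4

variable {g b : V → V → ℝ} {κ M δ C β : ℝ}

namespace IsGreenKernel

variable (hg : IsGreenKernel G g b D κ M δ C β)
include hg

theorem bound_nonneg [Nonempty V] : 0 ≤ M := by
  obtain ⟨v⟩ := ‹Nonempty V›
  exact (hg.nonneg v v).trans (hg.le v v)

theorem abs_charge_le (hD1 : 1 ≤ D) (x : V → Bool) (v : V) : |charge G x v| ≤ D * occ x v := by
  rw [charge, abs_mul, abs_of_nonneg (occ_nonneg x v), mul_comm]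
  refine mul_le_mul_of_nonneg_right ?_ (occ_nonneg x v)
  have h1 := nbr_le hg.degree_le x v
  have h2 := nbr_nonneg G x v
  rw [abs_le]
  constructor <;> linarith

theorem abs_potential_le (hD1 : 1 ≤ D) (x : V → Bool) (v : V) :
    |potential G g x v| ≤ D * (δ * mass x + C) := by
  refine (Finset.abs_sum_le_sum_abs _ _).trans ?_
  calc ∑ u, |g v u * charge G x u| ≤ ∑ u, D * (g v u * occ x u) := by
        refine Finset.sum_le_sum fun u _ => ?_
        rw [abs_mul, abs_of_nonneg (hg.nonneg v u), mul_left_comm]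
        exact mul_le_mul_of_nonneg_left (hg.abs_charge_le hD1 x u) (hg.nonneg v u)
    _ ≤ _ := by
        rw [← Finset.mul_sum]
        exact mul_le_mul_of_nonneg_left (hg.potential_le x v) (by linarith)

theorem abs_energy_le (hD1 : 1 ≤ D) (x : V → Bool) :
    |energy G g x| ≤ D ^ 2 * (δ * mass x + C) * mass x := by
  refine (Finset.abs_sum_le_sum_abs _ _).trans ?_
  calc ∑ v, |charge G x v * potential G g x v|
      ≤ ∑ v, D * occ x v * (D * (δ * mass x + C)) := by
        refine Finset.sum_le_sum fun v _ => ?_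
        rw [abs_mul]
        exact mul_le_mul (hg.abs_charge_le hD1 x v) (hg.abs_potential_le hD1 x v)
          (abs_nonneg _) (mul_nonneg (by linarith) (occ_nonneg x v))
    _ = _ := by
        rw [← Finset.sum_mul, ← Finset.mul_sum, mass]; ring

theorem laplacian_potential (x : V → Bool) (u : V) :
    ∑ w, adj G w u * (potential G g x w - potential G g x u) =
      κ * (∑ v, b u v * charge G x v - charge G x u) := by
  have h : ∀ v, charge G x v * ∑ w, adj G w u * (g w v - g u v) =
      κ * (b u v * charge G x v) - κ * (if u = v then charge G x v else 0) := by
    intro v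
    rw [hg.laplacian]
    split_ifs <;> ring
  have h' := Finset.sum_congr (rfl : (Finset.univ : Finset V) = Finset.univ) fun v _ => h v
  rw [Finset.sum_sub_distrib, ← Finset.mul_sum, ← Finset.mul_sum, Finset.sum_ite_eq,
    if_pos (Finset.mem_univ u)] at h'
  rw [mul_sub, ← h']
  simp only [potential, ← Finset.sum_sub_distrib, Finset.mul_sum]
  rw [Finset.sum_comm]
  exact Finset.sum_congr rfl fun v _ => Finset.sum_congr rfl fun w _ => by ring

omit hg in
theorem sum_occ_mul_charge (x : V → Bool) :
    ∑ u, occ x u * charge G x u = mass x - edgeSum G x := by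
  have h := two_mul_edgeSum G x
  have : ∀ u, occ x u * charge G x u = occ x u - occ x u * nbr G x u / 2 := by
    intro u
    rw [charge]
    linear_combination (1 - nbr G x u / 2) * occ_mul_self x u
  rw [Finset.sum_congr rfl fun u _ => this u, Finset.sum_sub_distrib, ← Finset.sum_div, ← h, mass]
  ring

theorem kernel_charge_ge (x : V → Bool) :
    mass x ^ 2 / Fintype.card V - edgeSum G x ≤
      ∑ u, occ x u * ∑ v, b u v * charge G x v := by
  have h1 : ∑ u, occ x u * ∑ v, b u v * charge G x v =
      ∑ u, occ x u * ∑ v, b u v * occ x v -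
        (∑ v, occ x v * nbr G x v * ∑ u, b v u * occ x u) / 2 := by
    have : ∑ v, occ x v * nbr G x v * ∑ u, b v u * occ x u =
        ∑ u, occ x u * ∑ v, b u v * (occ x v * nbr G x v) := by
      simp only [Finset.mul_sum]
      rw [Finset.sum_comm]
      refine Finset.sum_congr rfl fun u _ => Finset.sum_congr rfl fun v _ => ?_
      rw [hg.kernel_symm]; ring
    rw [this, Finset.sum_div, ← Finset.sum_sub_distrib]
    refine Finset.sum_congr rfl fun u _ => ?_
    rw [mul_div_assoc, ← mul_sub, Finset.sum_div, ← Finset.sum_sub_distrib]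
    congr 1
    exact Finset.sum_congr rfl fun v _ => by rw [charge]; ring
  have h2 : ∑ v, occ x v * nbr G x v * ∑ u, b v u * occ x u ≤ 2 * edgeSum G x := by
    rw [two_mul_edgeSum]
    refine Finset.sum_le_sum fun v _ => ?_
    refine mul_le_of_le_one_right (mul_nonneg (occ_nonneg x v) (nbr_nonneg G x v)) ?_
    rw [← hg.kernel_sum v]
    exact Finset.sum_le_sum fun u _ => mul_le_of_le_one_right (hg.kernel_nonneg v u)
      (occ_le_one x u)
  have h3 := hg.kernel_form_ge x
  rw [h1]
  linarith

theorem chargeDiff_form_ge [Nonempty V] (x : V → Bool) (w : V) :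
    (1 / 2) * (∑ u, adj G w u * (g w w - g w u) * occ x u) - M * exc G x w ≤
      cst G x w * ∑ v, chargeDiff G x w v * ∑ u, g v u * chargeDiff G x w u := by
  set N := nbr G x w with hN
  set S := ∑ u, adj G w u * occ x u * g w u with hS
  have hS0 : 0 ≤ S := Finset.sum_nonneg fun u _ =>
    mul_nonneg (mul_nonneg (adj_nonneg G w u) (occ_nonneg x u)) (hg.nonneg w u)
  have hSM : S ≤ M * N := by
    rw [hN, nbr, Finset.mul_sum]
    refine Finset.sum_le_sum fun u _ => ?_
    rw [mul_comm M]
    exact mul_le_mul_of_nonneg_left (hg.le w u) (mul_nonneg (adj_nonneg G w u) (occ_nonneg x u))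
  have hθ : ∑ u, adj G w u * (g w w - g w u) * occ x u = g w w * N - S := by
    rw [hN, nbr, hS, Finset.mul_sum, ← Finset.sum_sub_distrib]
    exact Finset.sum_congr rfl fun u _ => by ring
  have hin : ∀ v, ∑ u, g v u * chargeDiff G x w u =
      g v w * (1 - N / 2) - (∑ u, adj G w u * occ x u * g v u) / 2 := by
    intro v
    simp only [chargeDiff, mul_sub, Finset.sum_sub_distrib, mul_ite, mul_zero,
      Finset.sum_ite_eq', Finset.mem_univ, if_true]
    rw [Finset.sum_div]
    congr 1
    exact Finset.sum_congr rfl fun u _ => by ring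
  have hq : ∑ v, chargeDiff G x w v * ∑ u, g v u * chargeDiff G x w u =
      (1 - N / 2) ^ 2 * g w w - (1 - N / 2) * S +
        (∑ v, adj G w v * occ x v * ∑ u, adj G w u * occ x u * g v u) / 4 := by
    have e1 : ∀ F : V → ℝ, ∑ v, chargeDiff G x w v * F v =
        (1 - N / 2) * F w - (∑ v, adj G w v * occ x v * F v) / 2 := by
      intro F
      simp only [chargeDiff, sub_mul, Finset.sum_sub_distrib, ite_mul, zero_mul,
        Finset.sum_ite_eq', Finset.mem_univ, if_true]
      rw [Finset.sum_div]
      congr 1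
      exact Finset.sum_congr rfl fun u _ => by ring
    have e0 : ∀ v, adj G w v * occ x v * (g v w * (1 - N / 2) -
        (∑ u, adj G w u * occ x u * g v u) / 2) =
        adj G w v * occ x v * (g v w * (1 - N / 2)) -
          adj G w v * occ x v * ((∑ u, adj G w u * occ x u * g v u) / 2) := fun v => by ring
    rw [e1]
    simp only [hin, e0, Finset.sum_sub_distrib]
    have e2 : ∑ v, adj G w v * occ x v * (g v w * (1 - N / 2)) = (1 - N / 2) * S := by
      rw [hS, Finset.mul_sum]
      exact Finset.sum_congr rfl fun v _ => by rw [hg.symm v w]; ring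
    have e3 : ∑ v, adj G w v * occ x v * ((∑ u, adj G w u * occ x u * g v u) / 2) =
        (∑ v, adj G w v * occ x v * ∑ u, adj G w u * occ x u * g v u) / 2 := by
      rw [Finset.sum_div]
      exact Finset.sum_congr rfl fun v _ => by ring
    rw [e2, e3, ← hS]
    ring
  have hdiag : g w w * N ≤ ∑ v, adj G w v * occ x v * ∑ u, adj G w u * occ x u * g v u := by
    rw [hN, nbr, Finset.mul_sum]
    refine Finset.sum_le_sum fun v _ => ?_
    have h0 : ∀ u, 0 ≤ adj G w u * occ x u := fun u =>
      mul_nonneg (adj_nonneg G w u) (occ_nonneg x u)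
    have h1 : adj G w v * occ x v * g v v ≤ ∑ u, adj G w u * occ x u * g v u :=
      Finset.single_le_sum (f := fun u => adj G w u * occ x u * g v u)
        (fun u _ => mul_nonneg (h0 u) (hg.nonneg v u)) (Finset.mem_univ v)
    have h2 : (adj G w v * occ x v) * (adj G w v * occ x v) = adj G w v * occ x v := by
      have : adj G w v * adj G w v = adj G w v := by unfold adj; split_ifs <;> simp
      linear_combination (occ x v * occ x v) * this + adj G w v * occ_mul_self x v
    calc g w w * (adj G w v * occ x v) =
          adj G w v * occ x v * (adj G w v * occ x v * g v v) := by
          rw [← mul_assoc (_ * _) (_ * _), h2, hg.diag w v, mul_comm]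
      _ ≤ _ := mul_le_mul_of_nonneg_left h1 (h0 v)
  have hgw := hg.nonneg w w
  have hgM := hg.le w w
  have hM := hg.bound_nonneg
  rw [hq, hθ]
  rcases nbr_cases G x w with ⟨h1, h2, h3⟩ | ⟨h1, h2, h3⟩ | ⟨h1, h2, h3⟩
  · rw [h2, h3]
    rw [← hN] at h1
    rw [h1] at hSM ⊢
    linarith
  · rw [h2, h3]
    rw [← hN] at h1
    rw [h1] at hdiag ⊢
    linarith
  · rw [h2, h3]
    rw [← hN] at h1 ⊢
    have t1 : 0 ≤ (1 - N / 2) ^ 2 * g w w := by positivity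
    have t2 : 0 ≤ (N / 2 - 1) * S := mul_nonneg (by linarith) hS0
    have t3 : 0 ≤ g w w * N := mul_nonneg hgw (by linarith)
    have t4 : g w w * N ≤ M * N := mul_le_mul_of_nonneg_right hgM (by linarith)
    have t5 : M * 2 ≤ M * N := mul_le_mul_of_nonneg_left h1 hM
    linarith

theorem abs_pairSum_le [Nonempty V] (x : V → Bool) :
    |pairSum (fun u v => adj G u v * (g u u - g u v)) x| ≤ M * edgeSum G x := by
  have h : ∀ u v, |g u u - g u v| ≤ M := fun u v => by
    rw [abs_le]
    constructor <;> linarith [hg.nonneg u u, hg.nonneg u v, hg.le u u, hg.le u v]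
  rw [edgeSum, pairSum, pairSum, abs_mul, abs_of_pos (by norm_num : (0 : ℝ) < 1 / 2), mul_left_comm]
  refine mul_le_mul_of_nonneg_left ?_ (by norm_num)
  refine (Finset.abs_sum_le_sum_abs _ _).trans ?_
  rw [Finset.mul_sum]
  refine Finset.sum_le_sum fun u _ => (Finset.abs_sum_le_sum_abs _ _).trans ?_
  rw [Finset.mul_sum]
  refine Finset.sum_le_sum fun v _ => ?_
  rw [abs_mul, abs_mul, abs_of_nonneg (adj_nonneg G u v),
    abs_of_nonneg (mul_nonneg (occ_nonneg x u) (occ_nonneg x v))]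
  have := mul_le_mul_of_nonneg_right (h u v)
    (mul_nonneg (adj_nonneg G u v) (mul_nonneg (occ_nonneg x u) (occ_nonneg x v)))
  linarith

theorem gen_energy_ge [Nonempty V] {p : ℝ} (hp : 0 ≤ p) (hp1 : p ≤ 1) (hD1 : 1 ≤ D) (hκ : 0 ≤ κ)
    (x : V → Bool) :
    p * κ * (mass x ^ 2 / Fintype.card V) - p * κ * β * mass x - 2 * p * M * edgeSum G x
        - (2 * D * (δ * mass x + C) + M) * coalRate G p x ≤
      gen G p (fun x => energy G g x +
        (1 / 2) * pairSum (fun u v => adj G u v * (g u u - g u v)) x) x := by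
  set θ : V → V → ℝ := fun u v => adj G u v * (g u u - g u v) with hθ
  have hθs : ∀ u v, θ u v = θ v u := fun u v => by
    simp only [hθ]; rw [adj_comm G u v, hg.symm u v, hg.diag u v]
  have hθG : ∀ u v, ¬ G.Adj u v → θ u v = 0 := fun u v h => by simp [hθ, adj, h]
  have hθsum : ∀ u, ∑ w, θ w u = κ * (1 - b u u) := by
    intro u
    have h := hg.laplacian u u
    rw [if_pos rfl] at h
    have : ∑ w, θ w u = - ∑ w, adj G w u * (g w u - g u u) := by
      rw [← Finset.sum_neg_distrib]
      refine Finset.sum_congr rfl fun w _ => ?_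
      simp only [hθ]; rw [hg.diag w u]; ring
    rw [this, h]; ring
  have hB : ∑ u, occ x u * ∑ w, θ w u ≥ κ * (1 - β) * mass x := by
    rw [mass, Finset.mul_sum]
    refine Finset.sum_le_sum fun u _ => ?_
    rw [hθsum, mul_comm]
    refine mul_le_mul_of_nonneg_left (mul_le_mul_of_nonneg_left ?_ hκ) (occ_nonneg x u)
    linarith [hg.kernel_diag_le u]
  have hE2 := abs_le.1 (hg.abs_pairSum_le x)
  have hP := two_mul_pairSum θ x
  rw [gen_add, gen_const_mul, gen_pairSum G hθs hθG]
  set ψ := potential G g x with hψ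
  set q : V → ℝ := fun w => ∑ v, chargeDiff G x w v * ∑ u, g v u * chargeDiff G x w u with hqd
  have hgen : gen G p (energy G g) x = -2 * ∑ w, (p - occ x w) * (exc G x w * ψ w) +
      ∑ w, (p - occ x w) * ∑ u, adj G w u * occ x u * (ψ w - ψ u) +
      ∑ w, (p + occ x w - 2 * p * occ x w) * (cst G x w * q w) := by
    unfold gen
    rw [Finset.mul_sum, ← Finset.sum_add_distrib, ← Finset.sum_add_distrib]
    refine Finset.sum_congr rfl fun w _ => ?_
    rw [flipDiff_energy hg.symm]
    have h := cst_mul_chargeDiff_sum (G := G) x w ψ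
    linear_combination (p - occ x w) * h + 2 * cst G x w * q w * occ_mul_self x w
  have hT1 : -(D * (δ * mass x + C) * coalRate G p x) ≤
      - ∑ w, (p - occ x w) * (exc G x w * ψ w) := by
    rw [← sum_exc_mul, neg_le_neg_iff, Finset.mul_sum]
    refine Finset.sum_le_sum fun w _ => ?_
    have h1 := hg.abs_potential_le hD1 x w
    have h2 : |p - occ x w| ≤ p + occ x w := by
      rw [abs_le]; constructor <;> linarith [occ_nonneg x w]
    calc (p - occ x w) * (exc G x w * ψ w) ≤ |(p - occ x w) * (exc G x w * ψ w)| := le_abs_self _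
      _ = |p - occ x w| * exc G x w * |ψ w| := by
          rw [abs_mul, abs_mul, abs_of_nonneg (exc_nonneg G x w)]; ring
      _ ≤ ((p + occ x w) * exc G x w) * (D * (δ * mass x + C)) :=
          mul_le_mul (mul_le_mul_of_nonneg_right h2 (exc_nonneg G x w)) h1 (abs_nonneg _)
            (mul_nonneg (by linarith [occ_nonneg x w]) (exc_nonneg G x w))
      _ = _ := by ring
  have hT2 : ∑ w, (p - occ x w) * ∑ u, adj G w u * occ x u * (ψ w - ψ u) =
      p * ∑ u, occ x u * (κ * (∑ v, b u v * charge G x v - charge G x u)) := by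
    have ha : ∑ w, ∑ u, occ x w * (adj G w u * occ x u * (ψ w - ψ u)) = 0 := by
      have : ∑ w, ∑ u, occ x w * (adj G w u * occ x u * (ψ w - ψ u)) =
          - ∑ w, ∑ u, occ x w * (adj G w u * occ x u * (ψ w - ψ u)) := by
        conv_lhs => rw [Finset.sum_comm]
        simp only [← Finset.sum_neg_distrib]
        refine Finset.sum_congr rfl fun u _ => Finset.sum_congr rfl fun w _ => ?_
        rw [adj_comm G w u]; ring
      linarith
    have hb : ∑ w, ∑ u, adj G w u * occ x u * (ψ w - ψ u) =
        ∑ u, occ x u * (κ * (∑ v, b u v * charge G x v - charge G x u)) := by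
      rw [Finset.sum_comm]
      refine Finset.sum_congr rfl fun u _ => ?_
      rw [← hg.laplacian_potential, Finset.mul_sum]
      exact Finset.sum_congr rfl fun w _ => by ring
    simp only [sub_mul, Finset.sum_sub_distrib, ← Finset.mul_sum]
    simp only [← Finset.mul_sum] at ha
    rw [hb, ha, sub_zero]
  have hT2' : p * κ * (mass x ^ 2 / Fintype.card V - mass x) ≤
      p * ∑ u, occ x u * (κ * (∑ v, b u v * charge G x v - charge G x u)) := by
    have h1 := hg.kernel_charge_ge x
    have h2 := sum_occ_mul_charge (G := G) x
    have h3 : ∑ u, occ x u * (κ * (∑ v, b u v * charge G x v - charge G x u)) =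
        κ * (∑ u, occ x u * ∑ v, b u v * charge G x v - ∑ u, occ x u * charge G x u) := by
      rw [← Finset.sum_sub_distrib, Finset.mul_sum]
      exact Finset.sum_congr rfl fun u _ => by ring
    rw [h3, h2, mul_assoc]
    refine mul_le_mul_of_nonneg_left (mul_le_mul_of_nonneg_left ?_ hκ) hp
    linarith
  have hT3 : (1 / 2) * p * (∑ u, occ x u * ∑ w, θ w u) + (1 - 2 * p) * pairSum θ x -
      M * coalRate G p x ≤ ∑ w, (p + occ x w - 2 * p * occ x w) * (cst G x w * q w) := by
    have hs : ∑ u, occ x u * ∑ w, θ w u = ∑ w, ∑ u, θ w u * occ x u := by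
      rw [Finset.sum_comm]
      refine Finset.sum_congr rfl fun u _ => ?_
      rw [Finset.mul_sum]
      exact Finset.sum_congr rfl fun w _ => mul_comm _ _
    have hl : (1 / 2) * p * (∑ u, occ x u * ∑ w, θ w u) + (1 - 2 * p) * pairSum θ x -
        M * coalRate G p x =
        ∑ w, ((p + occ x w - 2 * p * occ x w) * ((1 / 2) * ∑ u, θ w u * occ x u) -
          M * ((p + occ x w) * exc G x w)) := by
      rw [hs, ← sum_exc_mul, Finset.sum_sub_distrib, ← Finset.mul_sum]
      have : ∀ w, (p + occ x w - 2 * p * occ x w) * ((1 / 2) * ∑ u, θ w u * occ x u) =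
          (1 / 2) * p * (∑ u, θ w u * occ x u) +
            (1 - 2 * p) / 2 * (occ x w * ∑ u, θ w u * occ x u) := fun w => by ring
      rw [Finset.sum_congr rfl fun w _ => this w, Finset.sum_add_distrib, ← Finset.mul_sum,
        ← Finset.mul_sum, ← hP]
      ring
    rw [hl]
    refine Finset.sum_le_sum fun w _ => ?_
    have h1 := hg.chargeDiff_form_ge x w
    have hM := hg.bound_nonneg
    have h2 : 0 ≤ p + occ x w - 2 * p * occ x w := by
      rcases occ_cases x w with h | h <;> rw [h] <;> linarith
    have h3 := mul_le_mul_of_nonneg_left h1 h2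
    have h4 : 0 ≤ 2 * p * occ x w * (M * exc G x w) :=
      mul_nonneg (mul_nonneg (by linarith) (occ_nonneg x w)) (mul_nonneg hM (exc_nonneg G x w))
    linarith
  rw [hgen, hT2]
  have hpB := mul_le_mul_of_nonneg_left hB hp
  have hpE := mul_le_mul_of_nonneg_left hE2.2 (by linarith : 0 ≤ 2 * p)
  linarith

end IsGreenKernel

/-- The coefficient of the corrected mass in the Lyapunov function. -/
def lyapunovCoeff (D M δ C : ℝ) : ℝ :=
  (36 * D + 24 * D ^ 2) * (8 * D ^ 2 * δ) + 8 * D * C + 8 * M + 4 * D ^ 2 * C + 2 * M * D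

/-- The Lyapunov function of the constrained Ising process. -/
def lyapunov (G : SimpleGraph V) (p D M δ C : ℝ) (g : V → V → ℝ) (x : V → Bool) : ℝ :=
  (8 * D ^ 2 * δ * corrMass G p D x ^ 2 + lyapunovCoeff D M δ C * corrMass G p D x) +
    (-1) * (energy G g x + (1 / 2) * pairSum (fun u v => adj G u v * (g u u - g u v)) x)

namespace IsGreenKernel

variable (hg : IsGreenKernel G g b D κ M δ C β)
include hg

theorem gen_lyapunov_le [Nonempty V] {p : ℝ} (hp : 0 ≤ p) (hp1 : p ≤ 1) (hD1 : 1 ≤ D)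
    (hκ : 0 ≤ κ) (hδ : 0 ≤ δ) (hC : 0 ≤ C) (x : V → Bool) :
    gen G p (lyapunov G p D M δ C g) x ≤
      48 * D ^ 6 * δ * (p * mass x) ^ 2 - p * κ * (mass x ^ 2 / Fintype.card V) +
        (24 * D ^ 6 * δ * p ^ 3 + lyapunovCoeff D M δ C * D ^ 2 * p ^ 2 + p * κ * β) * mass x := by
  have hM := hg.bound_nonneg
  have hA0 : 0 ≤ lyapunovCoeff D M δ C := by unfold lyapunovCoeff; positivity
  have h1 := gen_corrMass_le hp hD1 hg.degree_le x
  have h2 := gen_corrMass_sq_le hp hp1 hD1 hg.degree_le x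
  have h3 := hg.gen_energy_ge hp hp1 hD1 hκ x
  have hR := coalRate_nonneg (G := G) hp x
  have hE := mul_nonneg hp (edgeSum_nonneg G x)
  have hm := mass_nonneg x
  have hgen : gen G p (lyapunov G p D M δ C g) x =
      8 * D ^ 2 * δ * gen G p (fun x => corrMass G p D x ^ 2) x +
        lyapunovCoeff D M δ C * gen G p (corrMass G p D) x +
      (-1) * gen G p (fun x => energy G g x +
        (1 / 2) * pairSum (fun u v => adj G u v * (g u u - g u v)) x) x := by
    unfold lyapunov
    rw [gen_add, gen_add, gen_const_mul, gen_const_mul, gen_const_mul]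
  rw [hgen]
  have h2' := mul_le_mul_of_nonneg_left h2 (by positivity : 0 ≤ 8 * D ^ 2 * δ)
  have h1' := mul_le_mul_of_nonneg_left h1 hA0
  set R := coalRate G p x
  set E := p * edgeSum G x with hEdef
  set A := lyapunovCoeff D M δ C with hA
  have c1 : (8 * D ^ 2 * δ * (9 * D) + 2 * D * C + M - A / 4) * R ≤ 0 := by
    refine mul_nonpos_of_nonpos_of_nonneg ?_ hR
    have : 0 ≤ 24 * D ^ 2 * (8 * D ^ 2 * δ) + 4 * D ^ 2 * C + 4 * M + 2 * M * D := by positivity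
    rw [hA]; unfold lyapunovCoeff; linarith
  have c2 : (8 * D ^ 2 * δ * (12 * D ^ 3) + 2 * M - A * D / 2) * E ≤ 0 := by
    refine mul_nonpos_of_nonpos_of_nonneg ?_ hE
    have e1 : 0 ≤ (36 * D * (8 * D ^ 2 * δ) + 8 * D * C + 4 * D ^ 2 * C + 2 * M * D) * D := by
      positivity
    have e2 : 0 ≤ M * (D - 1) := mul_nonneg hM (by linarith)
    rw [hA]; unfold lyapunovCoeff; linarith
  have c3 : 0 ≤ (D - 1) * D * δ * (mass x * R) := by
    have : 0 ≤ D - 1 := by linarith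
    positivity
  linarith

theorem lyapunov_nonneg [Nonempty V] {p : ℝ} (hp : 0 ≤ p) (hD1 : 1 ≤ D) (hδ : 0 ≤ δ) (hC : 0 ≤ C)
    (x : V → Bool) : 0 ≤ lyapunov G p D M δ C g x := by
  have hM := hg.bound_nonneg
  have hA0 : 0 ≤ lyapunovCoeff D M δ C := by unfold lyapunovCoeff; positivity
  have hm := mass_nonneg x
  have hY := mass_le_corrMass (G := G) hp hD1 x
  have hH := abs_le.1 (hg.abs_energy_le hD1 x)
  have hP := abs_le.1 (hg.abs_pairSum_le x)
  have hE := mul_le_mul_of_nonneg_left (two_mul_edgeSum_le hg.degree_le x) hM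
  have hY2 : mass x ^ 2 / 4 ≤ corrMass G p D x ^ 2 := by nlinarith
  have h1 := mul_le_mul_of_nonneg_left hY2 (by positivity : 0 ≤ 8 * D ^ 2 * δ)
  have h2 := mul_le_mul_of_nonneg_left hY hA0
  have h3 : (2 * D ^ 2 * C + M * D) * mass x ≤ lyapunovCoeff D M δ C * mass x := by
    refine mul_le_mul_of_nonneg_right ?_ hm
    have : 0 ≤ (36 * D + 24 * D ^ 2) * (8 * D ^ 2 * δ) + 8 * D * C + 8 * M + 2 * D ^ 2 * C +
      M * D := by positivity
    unfold lyapunovCoeff; linarith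
  have h4 : 0 ≤ D ^ 2 * δ * mass x ^ 2 := by positivity
  have h5 : 0 ≤ M * D * mass x := mul_nonneg (mul_nonneg hM (by linarith)) hm
  unfold lyapunov
  linarith

theorem lyapunov_le [Nonempty V] {p : ℝ} (hp : 0 ≤ p) (hp1 : p ≤ 1) (hD1 : 1 ≤ D) (hδ : 0 ≤ δ)
    (hC : 0 ≤ C) (x : V → Bool) : lyapunov G p D M δ C g x ≤
      73 * D ^ 6 * δ * mass x ^ 2 + (4 * D ^ 2 * lyapunovCoeff D M δ C) * mass x := by
  have hM := hg.bound_nonneg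
  have hA0 : 0 ≤ lyapunovCoeff D M δ C := by unfold lyapunovCoeff; positivity
  have hm := mass_nonneg x
  have hY := mass_le_corrMass (G := G) hp hD1 x
  have hY' := corrMass_le hp1 hD1 hg.degree_le x
  have hH := abs_le.1 (hg.abs_energy_le hD1 x)
  have hP := abs_le.1 (hg.abs_pairSum_le x)
  have hE := mul_le_mul_of_nonneg_left (two_mul_edgeSum_le hg.degree_le x) hM
  have hY2 : corrMass G p D x ^ 2 ≤ (3 * D ^ 2 * mass x) ^ 2 :=
    pow_le_pow_left₀ (by linarith) hY' 2
  have h1 := mul_le_mul_of_nonneg_left hY2 (by positivity : 0 ≤ 8 * D ^ 2 * δ)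
  have h2 := mul_le_mul_of_nonneg_left hY' hA0
  have h3 : (D ^ 2 * C + M * D) * mass x ≤ D ^ 2 * lyapunovCoeff D M δ C * mass x := by
    refine mul_le_mul_of_nonneg_right ?_ hm
    have hD2 : 1 ≤ D ^ 2 := one_le_pow₀ hD1
    have e1 : lyapunovCoeff D M δ C ≤ D ^ 2 * lyapunovCoeff D M δ C :=
      le_mul_of_one_le_left hA0 hD2
    have : 0 ≤ (36 * D + 24 * D ^ 2) * (8 * D ^ 2 * δ) + 8 * D * C + 8 * M + 3 * D ^ 2 * C +
      M * D := by positivity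
    have e2 : D ^ 2 * C + M * D ≤ lyapunovCoeff D M δ C := by unfold lyapunovCoeff; linarith
    exact e2.trans e1
  have h4 : D ^ 2 * (δ * mass x ^ 2) ≤ D ^ 6 * (δ * mass x ^ 2) :=
    mul_le_mul_of_nonneg_right (pow_le_pow_right₀ hD1 (by norm_num)) (by positivity)
  have h5 : 0 ≤ M * D * mass x := mul_nonneg (mul_nonneg hM (by linarith)) hm
  unfold lyapunov
  linarith

end IsGreenKernel

/-- The coefficient of the linear part of the drift of the Lyapunov function. -/
def driftCoeff (c D κ M δ C B : ℝ) : ℝ :=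
  24 * D ^ 6 * δ * c ^ 3 + lyapunovCoeff D M δ C * D ^ 2 * c ^ 2 + c * κ * B

theorem IsGreenKernel.markovOp_lyapunov_le [Nonempty V] {c B n : ℝ}
    (hn : n = Fintype.card V) (hg : IsGreenKernel G g b D κ M δ C (B / n))
    (hc : 0 < c) (hcn : c ≤ n) (hD1 : 1 ≤ D) (hκ : 0 < κ) (hδ : 0 ≤ δ) (hC : 0 ≤ C)
    (hδκ : 96 * D ^ 6 * δ * c ≤ κ) (x : V → Bool) :
    markovOp (kcipKernel G (c / n)) (lyapunov G (c / n) D M δ C g) x ≤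
      lyapunov G (c / n) D M δ C g x + (-(c * κ / (4 * n ^ 3)) * mass x ^ 2 +
        driftCoeff c D κ M δ C B ^ 2 / (c * κ) / n ^ 3) := by
  have hn1 : 1 ≤ n := by rw [hn]; exact_mod_cast Fintype.card_pos
  have hn0 : 0 < n := by linarith
  have hp1 : c / n ≤ 1 := (div_le_one hn0).2 hcn
  have h := hg.gen_lyapunov_le (p := c / n) (by positivity) hp1 hD1 hκ.le hδ hC x
  rw [markovOp_kcipKernel, ← hn]
  rw [← hn] at h
  have hm := mass_nonneg x
  have h1 : (24 * D ^ 6 * δ * (c / n) ^ 3 + lyapunovCoeff D M δ C * D ^ 2 * (c / n) ^ 2 +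
      c / n * κ * (B / n)) ≤ driftCoeff c D κ M δ C B / n ^ 2 := by
    have e : (c / n) ^ 3 ≤ c ^ 3 / n ^ 2 := by
      rw [div_pow]
      exact div_le_div_of_nonneg_left (by positivity) (by positivity)
        (pow_le_pow_right₀ hn1 (by norm_num))
    have e' := mul_le_mul_of_nonneg_left e (by positivity : 0 ≤ 24 * D ^ 6 * δ)
    have e'' : driftCoeff c D κ M δ C B / n ^ 2 = 24 * D ^ 6 * δ * (c ^ 3 / n ^ 2) +
      lyapunovCoeff D M δ C * D ^ 2 * (c / n) ^ 2 + c / n * κ * (B / n) := by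
      unfold driftCoeff; field_simp
    linarith
  have h2 := mul_le_mul_of_nonneg_right h1 hm
  have h3 : 48 * D ^ 6 * δ * (c / n * mass x) ^ 2 ≤ c * κ / 2 * mass x ^ 2 / n ^ 2 := by
    have : 48 * D ^ 6 * δ * (c / n * mass x) ^ 2 =
      (96 * D ^ 6 * δ * c) * (c / 2 * mass x ^ 2 / n ^ 2) := by field_simp; ring
    rw [this]
    have := mul_le_mul_of_nonneg_right hδκ (by positivity : 0 ≤ c / 2 * mass x ^ 2 / n ^ 2)
    refine this.trans (le_of_eq ?_)
    field_simp
  have h4 : c / n * κ * (mass x ^ 2 / n) = c * κ * mass x ^ 2 / n ^ 2 := by field_simp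
  have h5 : driftCoeff c D κ M δ C B * mass x ≤
      c * κ / 4 * mass x ^ 2 + driftCoeff c D κ M δ C B ^ 2 / (c * κ) := by
    have hcκ : 0 < c * κ := by positivity
    have := div_nonneg (sq_nonneg (driftCoeff c D κ M δ C B - c * κ / 2 * mass x)) hcκ.le
    have e : (driftCoeff c D κ M δ C B - c * κ / 2 * mass x) ^ 2 / (c * κ) =
      driftCoeff c D κ M δ C B ^ 2 / (c * κ) - driftCoeff c D κ M δ C B * mass x +
        c * κ / 4 * mass x ^ 2 := by field_simp; ring
    linarith
  have h6 : gen G (c / n) (lyapunov G (c / n) D M δ C g) x ≤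
      (-(c * κ / 4) * mass x ^ 2 + driftCoeff c D κ M δ C B ^ 2 / (c * κ)) / n ^ 2 := by
    have := div_le_div_of_nonneg_right h5 (by positivity : 0 ≤ n ^ 2)
    have e1 : driftCoeff c D κ M δ C B / n ^ 2 * mass x =
      driftCoeff c D κ M δ C B * mass x / n ^ 2 := by ring
    have e2 : (-(c * κ / 4) * mass x ^ 2 + driftCoeff c D κ M δ C B ^ 2 / (c * κ)) / n ^ 2 =
      c * κ / 2 * mass x ^ 2 / n ^ 2 - c * κ * mass x ^ 2 / n ^ 2 +
      (c * κ / 4 * mass x ^ 2 + driftCoeff c D κ M δ C B ^ 2 / (c * κ)) / n ^ 2 := by ring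
    linarith
  have h7 := mul_le_mul_of_nonneg_left h6 (by positivity : 0 ≤ n⁻¹)
  have e : n⁻¹ * ((-(c * κ / 4) * mass x ^ 2 + driftCoeff c D κ M δ C B ^ 2 / (c * κ)) / n ^ 2) =
    -(c * κ / (4 * n ^ 3)) * mass x ^ 2 + driftCoeff c D κ M δ C B ^ 2 / (c * κ) / n ^ 3 := by
    field_simp
  linarith

/-- The mass halves, up to a constant, over a time of order `n ^ 3`, as soon as the graph has
Green kernels with sufficiently small `δ`. -/
theorem exists_iterate_markovOp_mass_le {c D κ ε : ℝ} (hc : 0 < c) (hD1 : 1 ≤ D) (hκ : 0 < κ)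
    (hε : 0 < ε) : ∃ δ : ℝ, 0 < δ ∧ ∀ C M B : ℝ, 0 ≤ C → ∃ K : ℝ, 0 ≤ K ∧
      ∀ (V : Type) [Fintype V] [Nonempty V] (G : SimpleGraph V) (g b : V → V → ℝ) (n : ℝ),
        n = Fintype.card V → IsGreenKernel G g b D κ M δ C (B / n) → c ≤ n → 1 ≤ ε * n ^ 3 →
        ∀ x : V → Bool, ((markovOp (kcipKernel G (c / n)))^[⌊ε * n ^ 3⌋₊] mass) x ≤
          mass x / 2 + K := by
  set E := Real.exp (2 * D ^ 2 * c ^ 2 * ε) with hE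
  have hE0 : 0 < E := Real.exp_pos _
  set ρ := 1 / (12 * D ^ 2 * E) with hρ
  have hρ0 : 0 < ρ := by positivity
  set F := 3 * D ^ 2 * E * (4 / (c * κ * ρ)) with hF
  have hF0 : 0 < F := by positivity
  refine ⟨min (κ / (96 * D ^ 6 * c)) (ε / (4 * F * (146 * D ^ 6))), by positivity, ?_⟩
  set δ := min (κ / (96 * D ^ 6 * c)) (ε / (4 * F * (146 * D ^ 6))) with hδ
  have hδ0 : 0 < δ := by positivity
  have hδ1 : 96 * D ^ 6 * δ * c ≤ κ := by
    have := (le_div_iff₀ (by positivity)).1 (min_le_left _ _ : δ ≤ κ / (96 * D ^ 6 * c))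
    linarith
  have hδ2 : F * (146 * D ^ 6 * δ / ε) ≤ 1 / 4 := by
    have := (le_div_iff₀ (by positivity)).1
      (min_le_right _ _ : δ ≤ ε / (4 * F * (146 * D ^ 6)))
    rw [← mul_div_assoc, div_le_iff₀ hε]
    linarith
  clear_value δ
  intro C M B hC
  set A := 4 * D ^ 2 * lyapunovCoeff D M δ C with hA
  set Θ := driftCoeff c D κ M δ C B ^ 2 / (c * κ) with hΘ
  have hΘ0 : 0 ≤ Θ := by positivity
  refine ⟨|F * (2 * A / ε + Θ) + 1 / 4|, abs_nonneg _, ?_⟩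
  intro V _ _ G g b n hn hg hcn hεn x
  have hM := hg.bound_nonneg
  have hA0 : 0 ≤ A := by rw [hA]; unfold lyapunovCoeff; positivity
  have hn1 : 1 ≤ n := by rw [hn]; exact_mod_cast Fintype.card_pos
  have hn0 : 0 < n := by linarith
  have hp1 : c / n ≤ 1 := (div_le_one hn0).2 hcn
  have hp0 : 0 ≤ c / n := by positivity
  have hm := mass_nonneg x
  set T := ⌊ε * n ^ 3⌋₊ with hT
  have hT1 : 1 ≤ T := Nat.one_le_floor_iff _ |>.2 hεn
  have hTle : (T : ℝ) ≤ ε * n ^ 3 := Nat.floor_le (by positivity)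
  have hTge : ε * n ^ 3 / 2 ≤ T := by
    have h1 := Nat.lt_floor_add_one (ε * n ^ 3)
    have h2 : (1 : ℝ) ≤ T := by exact_mod_cast hT1
    rw [← hT] at h1
    linarith
  have hT0 : (0 : ℝ) < T := by exact_mod_cast hT1
  have key := iterate_markovOp_le_of_lyapunov (K := kcipKernel G (c / n)) (V := mass)
    (Y := corrMass G (c / n) D) (Q := lyapunov G (c / n) D M δ C g)
    (a := c * κ / (4 * n ^ 3)) (b := Θ / n ^ 3) (r := 2 * D ^ 2 * c ^ 2 / n ^ 3)
    (κ := 3 * D ^ 2) (T := T) (kcipKernel_nonneg G hp0 hp1) (sum_kcipKernel G (c / n)) hT1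
    (by positivity) (by positivity) (hg.lyapunov_nonneg hp0 hD1 hδ0.le hC)
    (mass_le_corrMass hp0 hD1) (corrMass_le hp1 hD1 hg.degree_le) ?_ mass_nonneg
    (hg.markovOp_lyapunov_le hn hc hcn hD1 hκ hδ0.le hC hδ1) (ρ * (mass x + 1)) (by positivity)
    (by positivity) x
  swap
  · intro y
    rw [markovOp_kcipKernel, ← hn]
    have h1 := gen_corrMass_le hp0 hD1 hg.degree_le y
    have h2 := coalRate_nonneg (G := G) hp0 y
    have h3 := mul_nonneg hp0 (edgeSum_nonneg G y)
    have h3' : 0 ≤ D * (c / n * edgeSum G y) := mul_nonneg (by linarith) h3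
    have h4 := mul_le_mul_of_nonneg_left (mass_le_corrMass (G := G) hp0 hD1 y)
      (by positivity : 0 ≤ D ^ 2 * (c / n) ^ 2)
    have h5 : gen G (c / n) (corrMass G (c / n) D) y ≤
      D ^ 2 * (c / n) ^ 2 * (2 * corrMass G (c / n) D y) := by linarith
    have h6 := mul_le_mul_of_nonneg_left h5 (by positivity : 0 ≤ n⁻¹)
    have e : n⁻¹ * (D ^ 2 * (c / n) ^ 2 * (2 * corrMass G (c / n) D y)) =
      2 * D ^ 2 * c ^ 2 / n ^ 3 * corrMass G (c / n) D y := by field_simp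
    linarith
  refine key.trans ?_
  have hexp : Real.exp (2 * D ^ 2 * c ^ 2 / n ^ 3 * T) ≤ E := by
    refine Real.exp_le_exp.2 ?_
    calc 2 * D ^ 2 * c ^ 2 / n ^ 3 * T ≤ 2 * D ^ 2 * c ^ 2 / n ^ 3 * (ε * n ^ 3) :=
          mul_le_mul_of_nonneg_left hTle (by positivity)
      _ = _ := by field_simp
  have hQ0 := hg.lyapunov_nonneg hp0 hD1 hδ0.le hC x
  have hQ1 := hg.lyapunov_le hp0 hp1 hD1 hδ0.le hC x
  set Q := lyapunov G (c / n) D M δ C g x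
  have hQm : Q / (mass x + 1) ≤ 73 * D ^ 6 * δ * mass x + A := by
    rw [div_le_iff₀ (by linarith)]
    have : 0 ≤ 73 * D ^ 6 * δ * mass x + A := by positivity
    rw [← hA] at hQ1
    linarith
  have hΘm : Θ / (mass x + 1) ≤ Θ := div_le_self hΘ0 (by linarith)
  have hQT : Q / T ≤ 2 * Q / ε / n ^ 3 := by
    rw [div_div, div_le_div_iff₀ hT0 (by positivity)]
    have := mul_le_mul_of_nonneg_left hTge (by positivity : 0 ≤ 2 * Q)
    linarith
  have hfrac : (Q / T + Θ / n ^ 3) / (c * κ / (4 * n ^ 3) * (ρ * (mass x + 1))) ≤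
      4 / (c * κ * ρ) * (2 / ε * (73 * D ^ 6 * δ * mass x + A) + Θ) := by
    calc (Q / T + Θ / n ^ 3) / (c * κ / (4 * n ^ 3) * (ρ * (mass x + 1)))
        ≤ (2 * Q / ε / n ^ 3 + Θ / n ^ 3) / (c * κ / (4 * n ^ 3) * (ρ * (mass x + 1))) := by
          refine div_le_div_of_nonneg_right (by linarith) (by positivity)
      _ = 4 / (c * κ * ρ) * (2 / ε * (Q / (mass x + 1)) + Θ / (mass x + 1)) := by
          have : mass x + 1 ≠ 0 := by positivity
          field_simp
      _ ≤ _ := by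
          refine mul_le_mul_of_nonneg_left ?_ (by positivity)
          have := mul_le_mul_of_nonneg_left hQm (by positivity : 0 ≤ 2 / ε)
          linarith
  have hfin : 3 * D ^ 2 * E * (4 / (c * κ * ρ) * (2 / ε * (73 * D ^ 6 * δ * mass x + A) + Θ) +
      ρ * (mass x + 1)) ≤ mass x / 2 + |F * (2 * A / ε + Θ) + 1 / 4| := by
    have e1 : 3 * D ^ 2 * E * (ρ * (mass x + 1)) = (mass x + 1) / 4 := by
      rw [hρ]; field_simp; norm_num
    have e2 : 3 * D ^ 2 * E * (4 / (c * κ * ρ) * (2 / ε * (73 * D ^ 6 * δ * mass x + A) + Θ)) =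
        F * (146 * D ^ 6 * δ / ε) * mass x + F * (2 * A / ε + Θ) := by
      rw [hF]; ring
    have e3 := mul_le_mul_of_nonneg_right hδ2 hm
    have e4 := le_abs_self (F * (2 * A / ε + Θ) + 1 / 4)
    rw [mul_add, e1, e2]
    linarith
  refine le_trans ?_ hfin
  have hlast : 0 ≤ (Q / T + Θ / n ^ 3) / (c * κ / (4 * n ^ 3) * (ρ * (mass x + 1))) +
      ρ * (mass x + 1) := by positivity
  exact mul_le_mul (mul_le_mul_of_nonneg_left hexp (by positivity)) (by linarith) hlast
    (by positivity)

end Generator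

section Torus

variable {ℓ d : ℕ} [NeZero ℓ]

/-- The unit vector in direction `i` on the torus. -/
def unitVec (ℓ : ℕ) {d : ℕ} (i : Fin d) : Fin d → ZMod ℓ := fun j => if j = i then 1 else 0

/-- The heat kernel of the lazy simple random walk on the torus. -/
def heat : ℕ → (Fin d → ZMod ℓ) → ℝ
  | 0 => fun z => if z = 0 then 1 else 0
  | k + 1 => fun z => heat k z / 2 +
      (4 * d : ℝ)⁻¹ * ∑ i, (heat k (z + unitVec ℓ i) + heat k (z - unitVec ℓ i))

omit [NeZero ℓ] in
theorem heat_nonneg (k : ℕ) (z : Fin d → ZMod ℓ) : 0 ≤ heat k z := by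
  induction k generalizing z with
  | zero => simp only [heat]; split_ifs <;> simp
  | succ k ih =>
    simp only [heat]
    have : 0 ≤ ∑ i, (heat k (z + unitVec ℓ i) + heat k (z - unitVec ℓ i)) :=
      Finset.sum_nonneg fun i _ => add_nonneg (ih _) (ih _)
    have := ih z
    positivity

theorem sum_heat (hd : 0 < d) (k : ℕ) : ∑ z : Fin d → ZMod ℓ, heat k z = 1 := by
  induction k with
  | zero => simp [heat]
  | succ k ih =>
    have h1 : ∀ a : Fin d → ZMod ℓ, ∑ z : Fin d → ZMod ℓ, heat k (z + a) = 1 := fun a =>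
      (Equiv.sum_comp (Equiv.addRight a) (heat k)).trans ih
    have h2 : ∀ a : Fin d → ZMod ℓ, ∑ z : Fin d → ZMod ℓ, heat k (z - a) = 1 := fun a =>
      (Equiv.sum_comp (Equiv.subRight a) (heat k)).trans ih
    simp only [heat]
    rw [Finset.sum_add_distrib, ← Finset.sum_div, ih, ← Finset.mul_sum, Finset.sum_comm]
    simp only [Finset.sum_add_distrib, h1, h2]
    have : (d : ℝ) ≠ 0 := by positivity
    simp
    field_simp
    norm_num

omit [NeZero ℓ] in
theorem sum_heat_neighbors (hd : 0 < d) (k : ℕ) (z : Fin d → ZMod ℓ) :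
    ∑ i, ((heat k (z + unitVec ℓ i) - heat k z) + (heat k (z - unitVec ℓ i) - heat k z)) =
      4 * d * (heat (k + 1) z - heat k z) := by
  have : (d : ℝ) ≠ 0 := by positivity
  simp only [heat, Finset.sum_add_distrib, Finset.sum_sub_distrib]
  simp
  field_simp
  ring

/-- The eigenvalue of the lazy simple random walk on the character `ψ`. -/
def eigenvalue (ψ : AddChar (Fin d → ZMod ℓ) ℂ) : ℝ :=
  1 - (2 * d : ℝ)⁻¹ * ∑ i, (1 - (ψ (unitVec ℓ i)).re)

theorem abs_re_addChar_le (ψ : AddChar (Fin d → ZMod ℓ) ℂ) (z : Fin d → ZMod ℓ) :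
    |(ψ z).re| ≤ 1 :=
  (Complex.abs_re_le_norm _).trans (ψ.norm_apply z).le

theorem eigenvalue_nonneg (hd : 0 < d) (ψ : AddChar (Fin d → ZMod ℓ) ℂ) : 0 ≤ eigenvalue ψ := by
  have h : ∑ i, (1 - (ψ (unitVec ℓ i)).re) ≤ ∑ _i : Fin d, (2 : ℝ) :=
    Finset.sum_le_sum fun i _ => by
      have := abs_le.1 (abs_re_addChar_le ψ (unitVec ℓ i))
      linarith
  have h2 : (2 * d : ℝ)⁻¹ * ∑ i, (1 - (ψ (unitVec ℓ i)).re) ≤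
      (2 * d : ℝ)⁻¹ * ∑ _i : Fin d, (2 : ℝ) := mul_le_mul_of_nonneg_left h (by positivity)
  have h3 : (2 * d : ℝ)⁻¹ * ∑ _i : Fin d, (2 : ℝ) = 1 := by
    have : (d : ℝ) ≠ 0 := by positivity
    simp
    field_simp
  unfold eigenvalue
  linarith

omit [NeZero ℓ] in
theorem eigenvalue_one : eigenvalue (1 : AddChar (Fin d → ZMod ℓ) ℂ) = 1 := by
  simp [eigenvalue]

theorem heat_eq (hd : 0 < d) (k : ℕ) (z : Fin d → ZMod ℓ) :
    heat k z = (Fintype.card (Fin d → ZMod ℓ) : ℝ)⁻¹ *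
      ∑ ψ : AddChar (Fin d → ZMod ℓ) ℂ, eigenvalue ψ ^ k * (ψ z).re := by
  have hn : (Fintype.card (Fin d → ZMod ℓ) : ℝ) ≠ 0 := by exact_mod_cast Fintype.card_ne_zero
  induction k generalizing z with
  | zero =>
    have h := congrArg Complex.re (AddChar.sum_apply_eq_ite z)
    rw [Complex.re_sum] at h
    simp only [pow_zero, one_mul, h, heat]
    split_ifs
    · simp only [Complex.natCast_re]; field_simp
    · simp
  | succ k ih =>
    have hstep : ∀ ψ : AddChar (Fin d → ZMod ℓ) ℂ,
        (ψ z).re / 2 + (4 * d : ℝ)⁻¹ *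
          ∑ i, ((ψ (z + unitVec ℓ i)).re + (ψ (z - unitVec ℓ i)).re) =
        eigenvalue ψ * (ψ z).re := by
      intro ψ
      have h1 : ∀ i, (ψ (z + unitVec ℓ i)).re + (ψ (z - unitVec ℓ i)).re =
          2 * (ψ z).re - 2 * (ψ z).re * (1 - (ψ (unitVec ℓ i)).re) := by
        intro i
        rw [sub_eq_add_neg, AddChar.map_add_eq_mul, AddChar.map_add_eq_mul,
          AddChar.map_neg_eq_conj, Complex.mul_re, Complex.mul_re, Complex.conj_re,
          Complex.conj_im]
        ring
      have : (d : ℝ) ≠ 0 := by positivity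
      rw [Finset.sum_congr rfl fun i _ => h1 i, eigenvalue, Finset.sum_sub_distrib]
      simp only [← Finset.mul_sum, Finset.sum_const, Finset.card_univ, Fintype.card_fin,
        nsmul_eq_mul]
      field_simp
      ring
    have hr : ∀ ψ : AddChar (Fin d → ZMod ℓ) ℂ, eigenvalue ψ ^ (k + 1) * (ψ z).re =
        eigenvalue ψ ^ k * (ψ z).re / 2 + (4 * d : ℝ)⁻¹ *
          ∑ i, (eigenvalue ψ ^ k * (ψ (z + unitVec ℓ i)).re +
            eigenvalue ψ ^ k * (ψ (z - unitVec ℓ i)).re) := by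
      intro ψ
      rw [pow_succ, mul_assoc, ← hstep ψ]
      simp only [← mul_add, ← Finset.mul_sum]
      ring
    have hsum : ∑ ψ : AddChar (Fin d → ZMod ℓ) ℂ, eigenvalue ψ ^ (k + 1) * (ψ z).re =
        (∑ ψ : AddChar (Fin d → ZMod ℓ) ℂ, eigenvalue ψ ^ k * (ψ z).re) / 2 + (4 * d : ℝ)⁻¹ *
          ∑ i, (∑ ψ : AddChar (Fin d → ZMod ℓ) ℂ, eigenvalue ψ ^ k * (ψ (z + unitVec ℓ i)).re +
            ∑ ψ : AddChar (Fin d → ZMod ℓ) ℂ, eigenvalue ψ ^ k * (ψ (z - unitVec ℓ i)).re) := by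
      rw [Finset.sum_congr rfl fun ψ _ => hr ψ, Finset.sum_add_distrib, ← Finset.sum_div,
        ← Finset.mul_sum, Finset.sum_comm]
      simp only [Finset.sum_add_distrib]
    rw [hsum]
    simp only [heat, ih, ← mul_add, ← Finset.mul_sum]
    ring

theorem heat_neg (hd : 0 < d) (k : ℕ) (z : Fin d → ZMod ℓ) : heat k (-z) = heat k z := by
  simp only [heat_eq hd, AddChar.map_neg_eq_conj, Complex.conj_re]

theorem heat_le (hd : 0 < d) (k : ℕ) (z : Fin d → ZMod ℓ) :
    heat k z ≤ (Fintype.card (Fin d → ZMod ℓ) : ℝ)⁻¹ *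
      ∑ ψ : AddChar (Fin d → ZMod ℓ) ℂ, eigenvalue ψ ^ k := by
  rw [heat_eq hd]
  refine mul_le_mul_of_nonneg_left (Finset.sum_le_sum fun ψ _ => ?_) (by positivity)
  exact mul_le_of_le_one_right (pow_nonneg (eigenvalue_nonneg hd ψ) k)
    (le_of_abs_le (abs_re_addChar_le ψ z))

theorem sum_occ_heat_ge (hd : 0 < d) (k : ℕ) (x : (Fin d → ZMod ℓ) → Bool) :
    mass x ^ 2 / Fintype.card (Fin d → ZMod ℓ) ≤
      ∑ u, occ x u * ∑ v, heat k (u - v) * occ x v := by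
  have hre : ∀ (ψ : AddChar (Fin d → ZMod ℓ) ℂ),
      ∑ u, ∑ v, occ x u * occ x v * (ψ (u - v)).re =
        (∑ u, occ x u * (ψ u).re) ^ 2 + (∑ u, occ x u * (ψ u).im) ^ 2 := by
    intro ψ
    simp only [sq, Finset.sum_mul_sum, ← Finset.sum_add_distrib]
    refine Finset.sum_congr rfl fun u _ => Finset.sum_congr rfl fun v _ => ?_
    rw [sub_eq_add_neg, AddChar.map_add_eq_mul, AddChar.map_neg_eq_conj, Complex.mul_re,
      Complex.conj_re, Complex.conj_im]
    ring
  have h1 : ∑ u, occ x u * ∑ v, heat k (u - v) * occ x v =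
      (Fintype.card (Fin d → ZMod ℓ) : ℝ)⁻¹ * ∑ ψ : AddChar (Fin d → ZMod ℓ) ℂ,
        eigenvalue ψ ^ k * ∑ u, ∑ v, occ x u * occ x v * (ψ (u - v)).re := by
    have h2 : ∀ u, occ x u * ∑ v, heat k (u - v) * occ x v =
        ∑ v, ∑ ψ : AddChar (Fin d → ZMod ℓ) ℂ, (Fintype.card (Fin d → ZMod ℓ) : ℝ)⁻¹ *
          (eigenvalue ψ ^ k * (occ x u * occ x v * (ψ (u - v)).re)) := by
      intro u
      rw [Finset.mul_sum]
      refine Finset.sum_congr rfl fun v _ => ?_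
      rw [heat_eq hd, ← Finset.mul_sum, mul_assoc, mul_left_comm]
      congr 1
      rw [Finset.sum_mul, Finset.mul_sum]
      exact Finset.sum_congr rfl fun ψ _ => by ring
    rw [Finset.sum_congr rfl fun u _ => h2 u, Finset.sum_congr rfl fun u _ => Finset.sum_comm,
      Finset.sum_comm]
    simp only [Finset.mul_sum]
  rw [h1, div_eq_inv_mul]
  refine mul_le_mul_of_nonneg_left ?_ (by positivity)
  have h0 : ∀ ψ ∈ (Finset.univ : Finset (AddChar (Fin d → ZMod ℓ) ℂ)),
      0 ≤ eigenvalue ψ ^ k * ∑ u, ∑ v, occ x u * occ x v * (ψ (u - v)).re := by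
    intro ψ _
    rw [hre]
    have := eigenvalue_nonneg hd ψ
    positivity
  have := Finset.single_le_sum h0 (Finset.mem_univ 1)
  refine le_trans (le_of_eq ?_) this
  rw [hre, eigenvalue_one]
  simp [mass]

end Torus

section HeatDecay

theorem sum_exp_neg_mul_le {s : ℝ} (hs : 0 < s) (ℓ : ℕ) :
    ∑ j ∈ Finset.range ℓ, Real.exp (-(s * j)) ≤ 1 + 1 / s := by
  have hq : Real.exp (-s) ≤ 1 / (1 + s) := by
    rw [Real.exp_neg, ← one_div]
    exact one_div_le_one_div_of_le (by positivity) (by linarith [Real.add_one_le_exp s])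
  have hq1 : Real.exp (-s) < 1 := Real.exp_lt_one_iff.2 (by linarith)
  have h1 : ∀ j : ℕ, Real.exp (-(s * j)) = Real.exp (-s) ^ j := fun j => by
    rw [← Real.exp_nat_mul]; congr 1; ring
  rw [Finset.sum_congr rfl fun j _ => h1 j]
  have h2 := geom_sum_eq hq1.ne ℓ
  have h3 : 0 < Real.exp (-s) ^ ℓ := by positivity
  have h4 : s / (1 + s) ≤ 1 - Real.exp (-s) := by
    have : s / (1 + s) = 1 - 1 / (1 + s) := by field_simp; ring
    linarith
  rw [h2, ← neg_div_neg_eq, neg_sub, neg_sub, div_le_iff₀ (by linarith)]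
  calc 1 - Real.exp (-s) ^ ℓ ≤ 1 := by linarith
    _ = (1 + 1 / s) * (s / (1 + s)) := by field_simp; ring
    _ ≤ _ := mul_le_mul_of_nonneg_left h4 (by positivity)

theorem exp_neg_sq_le (y : ℝ) : Real.exp (-y ^ 2) ≤ 3 * Real.exp (-y) := by
  have h : Real.exp (-y ^ 2) ≤ Real.exp (1 + -y) :=
    Real.exp_le_exp.2 (by nlinarith [sq_nonneg (y - 1 / 2)])
  rw [Real.exp_add] at h
  have := Real.exp_one_lt_d9
  nlinarith [Real.exp_pos (-y)]

theorem cos_two_pi_mul_div_le {r ℓ : ℝ} (hr : 0 ≤ r) (hℓ : 0 < ℓ) (h : 2 * r ≤ ℓ) :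
    Real.cos (2 * Real.pi * r / ℓ) ≤ 1 - 8 * (r / ℓ) ^ 2 := by
  have hx : |2 * Real.pi * r / ℓ| ≤ Real.pi := by
    rw [abs_of_nonneg (by positivity), div_le_iff₀ hℓ]
    nlinarith [Real.pi_pos]
  refine (Real.cos_le_one_sub_mul_cos_sq hx).trans (le_of_eq ?_)
  field_simp
  ring

theorem exp_one_sub_cos_le {t s : ℝ} (ht : 0 ≤ t) {j ℓ : ℕ} (hj : j < ℓ)
    (hs : s ^ 2 * (ℓ : ℝ) ^ 2 = 8 * t) :
    Real.exp (-(t * (1 - Real.cos (2 * Real.pi * j / ℓ)))) ≤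
      3 * (Real.exp (-(s * j)) + Real.exp (-(s * (ℓ - j)))) := by
  have hℓ : (0 : ℝ) < ℓ := by exact_mod_cast Nat.zero_lt_of_lt hj
  have hj' : (j : ℝ) < ℓ := by exact_mod_cast hj
  have key : ∀ r : ℝ, 0 ≤ r → 2 * r ≤ ℓ →
      Real.exp (-(t * (1 - Real.cos (2 * Real.pi * r / ℓ)))) ≤ 3 * Real.exp (-(s * r)) := by
    intro r hr h
    refine le_trans (Real.exp_le_exp.2 ?_) (exp_neg_sq_le (s * r))
    have h1 := mul_le_mul_of_nonneg_left (cos_two_pi_mul_div_le hr hℓ h) ht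
    have h2 : t * (8 * (r / ℓ) ^ 2) = (s * r) ^ 2 := by
      have : t = s ^ 2 * (ℓ : ℝ) ^ 2 / 8 := by linarith
      rw [this]; field_simp
    linarith
  rcases le_total (2 * (j : ℝ)) ℓ with h | h
  · have := key j (by positivity) h
    have := Real.exp_pos (-(s * (ℓ - j)))
    linarith
  · have h1 := key (ℓ - j) (by linarith) (by linarith)
    have h2 : 2 * Real.pi * (ℓ - j) / ℓ = 2 * Real.pi - 2 * Real.pi * j / ℓ := by field_simp
    rw [h2, Real.cos_two_pi_sub] at h1
    have := Real.exp_pos (-(s * j))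
    linarith

theorem sum_exp_one_sub_cos_le {t s : ℝ} (ht : 0 ≤ t) (hs0 : 0 < s) (ℓ : ℕ)
    (hs : s ^ 2 * (ℓ : ℝ) ^ 2 = 8 * t) :
    ∑ j ∈ Finset.range ℓ, Real.exp (-(t * (1 - Real.cos (2 * Real.pi * j / ℓ)))) ≤
      6 * (1 + 1 / s) := by
  have h1 := sum_exp_neg_mul_le hs0 ℓ
  have h2 : ∑ j ∈ Finset.range ℓ, Real.exp (-(s * (ℓ - j))) ≤ 1 + 1 / s := by
    rw [← Finset.sum_range_reflect] at h1
    refine le_trans (Finset.sum_le_sum fun j hj => Real.exp_le_exp.2 ?_) h1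
    have hj' := Finset.mem_range.1 hj
    rw [Nat.cast_sub (by omega), Nat.cast_sub (by omega)]
    push_cast
    nlinarith
  calc _ ≤ ∑ j ∈ Finset.range ℓ, 3 * (Real.exp (-(s * j)) + Real.exp (-(s * (ℓ - j)))) :=
        Finset.sum_le_sum fun j hj => exp_one_sub_cos_le ht (Finset.mem_range.1 hj) hs
    _ ≤ _ := by rw [← Finset.mul_sum, Finset.sum_add_distrib]; linarith

theorem sum_addChar_re_one (ℓ : ℕ) [NeZero ℓ] (F : ℝ → ℝ) :
    ∑ φ : AddChar (ZMod ℓ) ℂ, F (φ 1).re =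
      ∑ j ∈ Finset.range ℓ, F (Real.cos (2 * Real.pi * j / ℓ)) := by
  rw [← Equiv.sum_comp (AddChar.zmodAddEquiv (n := ℓ)).toEquiv]
  obtain ⟨m, rfl⟩ := Nat.exists_eq_succ_of_ne_zero (NeZero.ne ℓ)
  rw [← Fin.sum_univ_eq_sum_range (fun j => F (Real.cos (2 * Real.pi * j / (m.succ : ℕ))))]
  refine Finset.sum_congr rfl fun (j : Fin (m + 1)) _ => ?_
  have h : (AddChar.zmodAddEquiv (n := m + 1) j) (1 : ZMod (m + 1)) =
      ((AddChar.zmod (m + 1) j 1 : Circle) : ℂ) := rfl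
  have h1 := AddChar.zmod_intCast (m + 1) (j.val : ℤ) 1
  have h2 : ((j.val : ℤ) : ZMod (m + 1)) = j := by
    rw [Int.cast_natCast]
    exact Fin.cast_val_eq_self j
  rw [h2] at h1
  congr 1
  change ((AddChar.zmodAddEquiv (n := m + 1) j) (1 : ZMod (m + 1))).re = _
  rw [h]
  have h3 : ((1 : ℤ) : ZMod (m + 1)) = 1 := by simp
  rw [h3] at h1
  rw [h1, Circle.coe_exp, Complex.exp_ofReal_mul_I_re]
  congr 1
  push_cast
  ring

variable {ℓ d : ℕ} [NeZero ℓ]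

omit [NeZero ℓ] in
theorem eigenvalue_pow_le (ψ : AddChar (Fin d → ZMod ℓ) ℂ) (h0 : 0 ≤ eigenvalue ψ) (k : ℕ) :
    eigenvalue ψ ^ k ≤
      ∏ i, Real.exp (-((k / (2 * d : ℝ)) * (1 - (ψ (unitVec ℓ i)).re))) := by
  have h := Real.add_one_le_exp (-((2 * d : ℝ)⁻¹ * ∑ i, (1 - (ψ (unitVec ℓ i)).re)))
  have h1 : eigenvalue ψ ≤ Real.exp (-((2 * d : ℝ)⁻¹ * ∑ i, (1 - (ψ (unitVec ℓ i)).re))) := by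
    unfold eigenvalue; linarith
  refine (pow_le_pow_left₀ h0 h1 k).trans (le_of_eq ?_)
  rw [← Real.exp_sum, ← Real.exp_nat_mul, Finset.sum_neg_distrib, ← Finset.mul_sum]
  congr 1
  ring

theorem sum_eigenvalue_pow_le (hd : 0 < d) (k : ℕ) :
    ∑ ψ : AddChar (Fin d → ZMod ℓ) ℂ, eigenvalue ψ ^ k ≤
      (∑ φ : AddChar (ZMod ℓ) ℂ, Real.exp (-((k / (2 * d : ℝ)) * (1 - (φ 1).re)))) ^ d := by
  let r : AddChar (Fin d → ZMod ℓ) ℂ → Fin d → AddChar (ZMod ℓ) ℂ := fun ψ i =>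
    ψ.compAddMonoidHom (AddMonoidHom.single (fun _ => ZMod ℓ) i)
  have hr : Function.Injective r := by
    intro ψ ψ' h
    have h1 : ∀ i a, ψ (Pi.single i a) = ψ' (Pi.single i a) := fun i a =>
      DFunLike.congr_fun (congrFun h i) a
    exact AddChar.toAddMonoidHomEquiv.injective
      (AddMonoidHom.functions_ext _ _ _ fun i a => congrArg Additive.ofMul (h1 i a))
  have hu : ∀ ψ i, r ψ i 1 = ψ (unitVec ℓ i) := by
    intro ψ i
    change ψ (Pi.single i 1) = _
    congr 1
    ext j
    simp [unitVec, Pi.single_apply]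
  have hp := Fintype.sum_pow
    (fun φ : AddChar (ZMod ℓ) ℂ => Real.exp (-((k / (2 * d : ℝ)) * (1 - (φ 1).re)))) d
  rw [hp]
  calc _ ≤ ∑ ψ : AddChar (Fin d → ZMod ℓ) ℂ,
        ∏ i, Real.exp (-((k / (2 * d : ℝ)) * (1 - (r ψ i 1).re))) := by
        refine Finset.sum_le_sum fun ψ _ => ?_
        simp only [hu]
        exact eigenvalue_pow_le ψ (eigenvalue_nonneg hd ψ) k
    _ = ∑ p ∈ Finset.univ.image r,
        ∏ i, Real.exp (-((k / (2 * d : ℝ)) * (1 - (p i 1).re))) :=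
        by rw [Finset.sum_image hr.injOn]
    _ ≤ _ := Finset.sum_le_sum_of_subset_of_nonneg (Finset.subset_univ _)
        fun _ _ _ => Finset.prod_nonneg fun _ _ => (Real.exp_pos _).le

omit [NeZero ℓ] in
theorem exists_heat_le (hd : 3 ≤ d) :
    ∃ A : ℝ, 0 < A ∧ ∀ (ℓ : ℕ) [NeZero ℓ] (k : ℕ), 1 ≤ k → ∀ z : Fin d → ZMod ℓ,
      heat k z ≤ A / (ℓ : ℝ) ^ d + A * (1 / √k) ^ 3 := by
  have hd0 : (0 : ℝ) < d := by exact_mod_cast (by omega : 0 < d)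
  refine ⟨2 ^ (d - 1) * (6 ^ d + (3 * √d) ^ d), by positivity, fun ℓ _ k hk z => ?_⟩
  have hℓ : (0 : ℝ) < ℓ := by exact_mod_cast NeZero.pos ℓ
  have hk1 : (1 : ℝ) ≤ √k := Real.one_le_sqrt.2 (by exact_mod_cast hk)
  have hk0 : (0 : ℝ) < √k := by linarith
  have hsd : (0 : ℝ) < √d := Real.sqrt_pos.2 hd0
  have hs : (2 * √k / (√d * ℓ)) ^ 2 * (ℓ : ℝ) ^ 2 = 8 * (k / (2 * d : ℝ)) := by
    rw [div_pow, mul_pow, mul_pow, Real.sq_sqrt (by positivity), Real.sq_sqrt (by positivity)]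
    field_simp
    ring
  have h1 : ∑ φ : AddChar (ZMod ℓ) ℂ, Real.exp (-((k / (2 * d : ℝ)) * (1 - (φ 1).re))) ≤
      6 * (1 + 1 / (2 * √k / (√d * ℓ))) := by
    rw [sum_addChar_re_one ℓ fun y => Real.exp (-((k / (2 * d : ℝ)) * (1 - y)))]
    exact sum_exp_one_sub_cos_le (by positivity) (by positivity) ℓ hs
  have h2 := (heat_le (by omega) k z).trans (mul_le_mul_of_nonneg_left
    ((sum_eigenvalue_pow_le (ℓ := ℓ) (d := d) (by omega) k).trans
      (pow_le_pow_left₀ (Finset.sum_nonneg fun _ _ => (Real.exp_pos _).le) h1 d))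
    (by positivity))
  have hcard : (Fintype.card (Fin d → ZMod ℓ) : ℝ) = (ℓ : ℝ) ^ d := by simp [ZMod.card]
  rw [hcard, ← inv_pow, ← mul_pow] at h2
  have h3 : (ℓ : ℝ)⁻¹ * (6 * (1 + 1 / (2 * √k / (√d * ℓ)))) = 6 * (1 / ℓ) + 3 * √d * (1 / √k) := by
    field_simp
    ring
  rw [h3] at h2
  have h4 := add_pow_le (show (0 : ℝ) ≤ 6 * (1 / ℓ) by positivity)
    (show (0 : ℝ) ≤ 3 * √d * (1 / √k) by positivity) d
  have h5 : (1 / √k : ℝ) ^ d ≤ (1 / √k) ^ 3 :=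
    pow_le_pow_of_le_one (by positivity) ((div_le_one hk0).2 hk1) hd
  have h6 : (6 * (1 / ℓ : ℝ)) ^ d ≤ (6 ^ d + (3 * √d) ^ d) / (ℓ : ℝ) ^ d := by
    rw [mul_pow, one_div_pow, mul_one_div]
    gcongr
    linarith [show (0 : ℝ) ≤ (3 * √d) ^ d by positivity]
  have h7 : (3 * √d * (1 / √k)) ^ d ≤ (6 ^ d + (3 * √d) ^ d) * (1 / √k) ^ 3 := by
    rw [mul_pow]
    refine mul_le_mul ?_ h5 (by positivity) (by positivity)
    linarith [show (0 : ℝ) ≤ 6 ^ d by positivity]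
  refine h2.trans (h4.trans ?_)
  rw [mul_div_assoc, mul_assoc (2 ^ (d - 1) : ℝ), ← mul_add]
  exact mul_le_mul_of_nonneg_left (add_le_add h6 h7) (by positivity)

end HeatDecay

section TorusGreen

variable {ℓ d : ℕ}

theorem torusGraph_adj_iff (u w : Fin d → ZMod ℓ) :
    (torusGraph ℓ d).Adj w u ↔ w ≠ u ∧ ∃ i, w = u + unitVec ℓ i ∨ w = u - unitVec ℓ i := by
  have h : ∀ i, (u = w + unitVec ℓ i ↔ w = u - unitVec ℓ i) := fun i =>
    ⟨fun h => by rw [h]; abel, fun h => by rw [h]; abel⟩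
  have h' : (torusGraph ℓ d).Adj w u ↔
      w ≠ u ∧ ((∃ i, u = w + unitVec ℓ i) ∨ ∃ i, w = u + unitVec ℓ i) := Iff.rfl
  rw [h', ← exists_or]
  simp only [h]
  exact and_congr_right fun _ => exists_congr fun _ => or_comm

theorem sum_adj_torusGraph [NeZero ℓ] (hℓ : 3 ≤ ℓ) (F : (Fin d → ZMod ℓ) → ℝ)
    (u : Fin d → ZMod ℓ) :
    ∑ w, adj (torusGraph ℓ d) w u * F w =
      ∑ i, (F (u + unitVec ℓ i) + F (u - unitVec ℓ i)) := by
  have h1 : (1 : ZMod ℓ) ≠ 0 := fun h => by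
    have := (ZMod.natCast_eq_zero_iff 1 ℓ).1 (by exact_mod_cast h)
    have := Nat.le_of_dvd one_pos this
    omega
  have h2 : (1 : ZMod ℓ) ≠ -1 := fun h => by
    have h3 : ((2 : ℕ) : ZMod ℓ) = 0 := by
      push_cast
      linear_combination h
    have := Nat.le_of_dvd two_pos ((ZMod.natCast_eq_zero_iff 2 ℓ).1 h3)
    omega
  have hne : ∀ i : Fin d, unitVec ℓ i ≠ 0 := fun i h => by
    have := congrFun h i
    simp [unitVec] at this
    exact h1 this
  have hinj : ∀ i j : Fin d, unitVec ℓ i = unitVec ℓ j → i = j := fun i j h => by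
    by_contra hij
    have := congrFun h i
    simp [unitVec, hij] at this
    exact h1 this
  have hneg : ∀ i j : Fin d, unitVec ℓ i ≠ -unitVec ℓ j := fun i j h => by
    have := congrFun h i
    by_cases hij : i = j
    · simp [unitVec, hij] at this
      exact h2 this
    · simp [unitVec, hij] at this
      exact h1 this
  let e : Fin d × Bool → (Fin d → ZMod ℓ) := fun q =>
    if q.2 then u + unitVec ℓ q.1 else u - unitVec ℓ q.1
  have he : Function.Injective e := by
    rintro ⟨i, s⟩ ⟨j, t⟩ h
    cases s <;> cases t <;> simp only [e, if_true, Bool.false_eq_true, if_false] at h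
    · rw [hinj i j (by simpa using h)]
    · rw [sub_eq_add_neg] at h
      exact absurd (add_left_cancel h).symm (hneg j i)
    · rw [sub_eq_add_neg] at h
      exact absurd (add_left_cancel h) (hneg i j)
    · rw [hinj i j (by simpa using h)]
  have himage : (Finset.univ.filter fun w => (torusGraph ℓ d).Adj w u) = Finset.univ.image e := by
    ext w
    simp only [Finset.mem_filter, Finset.mem_univ, true_and, Finset.mem_image, Prod.exists,
      Bool.exists_bool, torusGraph_adj_iff, e, if_true, Bool.false_eq_true, if_false]
    constructor
    · rintro ⟨-, i, h | h⟩
      · exact ⟨i, Or.inr h.symm⟩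
      · exact ⟨i, Or.inl h.symm⟩
    · rintro ⟨i, h | h⟩
      · refine ⟨fun h' => hne i ?_, i, Or.inr h.symm⟩
        simpa [h'] using h
      · refine ⟨fun h' => hne i ?_, i, Or.inl h.symm⟩
        simpa [h'] using h
  simp only [adj, ite_mul, one_mul, zero_mul]
  rw [← Finset.sum_filter, himage, Finset.sum_image he.injOn, Fintype.sum_prod_type]
  simp [e]

theorem exists_sum_inv_sqrt_cube_le {η : ℝ} (hη : 0 < η) :
    ∃ R : ℕ, 1 ≤ R ∧ ∀ S : ℕ,
      ∑ k ∈ Finset.range S, (1 / √((R + k : ℕ) : ℝ)) ^ 3 ≤ η := by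
  have hsum : Summable fun k : ℕ => (1 / √(k : ℝ)) ^ 3 := by
    refine (Real.summable_one_div_nat_rpow.2 (by norm_num : (1 : ℝ) < 3 / 2)).congr fun k => ?_
    rw [one_div_pow, Real.sqrt_eq_rpow, ← Real.rpow_mul_natCast (by positivity)]
    norm_num
  obtain ⟨R, hR, hR1⟩ := (((tendsto_sum_nat_add fun k : ℕ => (1 / √(k : ℝ)) ^ 3).eventually
    (gt_mem_nhds hη)).and (Filter.eventually_ge_atTop 1)).exists
  refine ⟨R, hR1, fun S => ?_⟩
  have h := ((summable_nat_add_iff R).2 hsum).sum_le_tsum (Finset.range S)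
    fun k _ => by positivity
  simp only [add_comm R]
  exact h.trans hR.le

theorem sum_heat_mul_le [NeZero ℓ] (k : ℕ) (u : Fin d → ZMod ℓ)
    {f : (Fin d → ZMod ℓ) → ℝ} {a : ℝ} (hf : ∀ v, 0 ≤ f v)
    (ha : ∀ z : Fin d → ZMod ℓ, heat k z ≤ a) :
    ∑ v, heat k (u - v) * f v ≤ a * ∑ v, f v := by
  rw [Finset.mul_sum]
  exact Finset.sum_le_sum fun v _ => mul_le_mul_of_nonneg_right (ha _) (hf v)

theorem sum_heat_sub [NeZero ℓ] (hd : 0 < d) (k : ℕ) (u : Fin d → ZMod ℓ) :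
    ∑ v, heat k (u - v) = 1 :=
  (Equiv.sum_comp (Equiv.subLeft u) (heat k)).trans (sum_heat hd k)

theorem sum_heat_mul_le_one [NeZero ℓ] (hd : 0 < d) (k : ℕ) (u : Fin d → ZMod ℓ)
    {f : (Fin d → ZMod ℓ) → ℝ} (hf : ∀ v, f v ≤ 1) :
    ∑ v, heat k (u - v) * f v ≤ 1 := by
  rw [← sum_heat_sub hd k u]
  exact Finset.sum_le_sum fun v _ => mul_le_of_le_one_right (heat_nonneg _ _) (hf v)

/-- The Green kernel of the lazy walk on the torus, killed after `S` steps. -/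
def torusGreen (ℓ : ℕ) {d : ℕ} (S : ℕ) (u v : Fin d → ZMod ℓ) : ℝ :=
  ∑ k ∈ Finset.range S, heat k (u - v)

theorem torusGreen_laplacian [NeZero ℓ] (hℓ : 3 ≤ ℓ) (hd : 0 < d) (S : ℕ)
    (u v : Fin d → ZMod ℓ) :
    ∑ w, adj (torusGraph ℓ d) w u * (torusGreen ℓ S w v - torusGreen ℓ S u v) =
      4 * d * (heat S (u - v) - if u = v then 1 else 0) := by
  rw [sum_adj_torusGraph hℓ fun w => torusGreen ℓ S w v - torusGreen ℓ S u v]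
  simp only [torusGreen, ← Finset.sum_sub_distrib, ← Finset.sum_add_distrib]
  rw [Finset.sum_comm]
  have h : ∀ k, ∑ i, (heat k (u + unitVec ℓ i - v) - heat k (u - v) +
      (heat k (u - unitVec ℓ i - v) - heat k (u - v))) =
      4 * d * heat (k + 1) (u - v) - 4 * d * heat k (u - v) := by
    intro k
    have := sum_heat_neighbors (ℓ := ℓ) hd k (u - v)
    rw [← mul_sub, ← this]
    refine Finset.sum_congr rfl fun i _ => ?_
    rw [add_sub_right_comm, sub_right_comm u]
  rw [Finset.sum_congr rfl fun k _ => h k, Finset.sum_range_sub fun k => 4 * d * heat k (u - v)]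
  simp only [heat, sub_eq_zero]
  ring

theorem exists_isGreenKernel_torusGraph (hd : 3 ≤ d) {δ : ℝ} (hδ : 0 < δ) :
    ∃ (C M B : ℝ) (N : ℕ), 0 ≤ C ∧ ∀ (ℓ : ℕ) [NeZero ℓ], N < ℓ ^ d →
      ∃ g b : (Fin d → ZMod ℓ) → (Fin d → ZMod ℓ) → ℝ,
        IsGreenKernel (torusGraph ℓ d) g b (2 * d) (4 * d) M δ C (B / ((ℓ ^ d : ℕ) : ℝ)) := by
  have hd0 : 0 < d := by omega
  obtain ⟨A, hA, hheat⟩ := exists_heat_le hd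
  set γ : ℝ := δ / (2 * A) with hγdef
  have hγ : 0 < γ := by positivity
  obtain ⟨R, hR1, hR⟩ := exists_sum_inv_sqrt_cube_le hγ
  refine ⟨R, δ + R, A + 2 * A / γ, 2 ^ d + ⌈2 / γ⌉₊, by positivity, fun ℓ _ hN => ?_⟩
  have hℓ : 3 ≤ ℓ := by
    by_contra h
    have := Nat.pow_le_pow_left (show ℓ ≤ 2 by omega) d
    omega
  set n : ℝ := ((ℓ ^ d : ℕ) : ℝ) with hn
  have hn' : (ℓ : ℝ) ^ d = n := by simp [hn]
  have hn0 : 0 < n := by rw [← hn']; positivity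
  have hγn : 2 ≤ γ * n := by
    have h0 := Nat.zero_le (2 ^ d)
    have h1 : (2 / γ : ℝ) ≤ n := (Nat.le_ceil _).trans (by rw [hn]; exact Nat.cast_le.2 (by omega))
    rw [div_le_iff₀ hγ] at h1
    linarith
  set S : ℕ := ⌊γ * n⌋₊ with hS
  have hSle : (S : ℝ) ≤ γ * n := Nat.floor_le (by positivity)
  have hSge : γ * n / 2 ≤ S := by
    have := Nat.lt_floor_add_one (γ * n)
    rw [← hS] at this
    linarith
  have hS1 : 1 ≤ S := by
    have : (1 : ℝ) ≤ S := by linarith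
    exact_mod_cast this
  have hpot : ∀ f : (Fin d → ZMod ℓ) → ℝ, (∀ v, 0 ≤ f v) → (∀ v, f v ≤ 1) → ∀ u,
      ∑ v, torusGreen ℓ S u v * f v ≤ δ * ∑ v, f v + R := by
    intro f hf0 hf1 u
    have hf : 0 ≤ ∑ v, f v := Finset.sum_nonneg fun v _ => hf0 v
    have e : ∑ v, torusGreen ℓ S u v * f v =
        ∑ k ∈ Finset.range S, ∑ v, heat k (u - v) * f v := by
      simp only [torusGreen, Finset.sum_mul]
      exact Finset.sum_comm
    have h1 : ∑ k ∈ Finset.range S, ∑ v, heat k (u - v) * f v ≤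
        ∑ k ∈ Finset.range (R + S), ∑ v, heat k (u - v) * f v :=
      Finset.sum_le_sum_of_subset_of_nonneg (Finset.range_mono (by omega)) fun k _ _ =>
        Finset.sum_nonneg fun v _ => mul_nonneg (heat_nonneg _ _) (hf0 v)
    have h2 : ∑ k ∈ Finset.range R, ∑ v, heat k (u - v) * f v ≤ R := by
      refine (Finset.sum_le_sum fun k _ => sum_heat_mul_le_one hd0 k u hf1).trans ?_
      simp
    have h3 : ∑ k ∈ Finset.range S, ∑ v, heat (R + k) (u - v) * f v ≤ δ * ∑ v, f v := by
      refine (Finset.sum_le_sum fun k _ =>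
        sum_heat_mul_le (R + k) u hf0 (hheat ℓ (R + k) (by omega))).trans ?_
      rw [← Finset.sum_mul]
      refine mul_le_mul_of_nonneg_right ?_ hf
      rw [Finset.sum_add_distrib, ← Finset.mul_sum, hn']
      have h4 := mul_le_mul_of_nonneg_left (hR S) hA.le
      have h5 : ∑ _k ∈ Finset.range S, A / n ≤ A * γ := by
        rw [Finset.sum_const, Finset.card_range, nsmul_eq_mul, mul_div_assoc',
          div_le_iff₀ hn0]
        nlinarith
      have h6 : A * γ = δ / 2 := by rw [hγdef]; field_simp
      linarith
    rw [e]
    rw [Finset.sum_range_add] at h1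
    linarith
  have hsymm : ∀ k (u v : Fin d → ZMod ℓ), heat k (u - v) = heat k (v - u) := fun k u v => by
    rw [← heat_neg hd0, neg_sub]
  refine ⟨torusGreen ℓ S, fun u v => heat S (u - v), ?_⟩
  constructor
  · intro u
    have := sum_adj_torusGraph hℓ (fun _ => 1) u
    simp only [mul_one] at this
    rw [this]
    simp
    linarith
  · intro u v
    exact Finset.sum_congr rfl fun k _ => hsymm k u v
  · intro u v
    exact Finset.sum_nonneg fun k _ => heat_nonneg _ _
  · intro u v
    have := hpot (fun w => if w = v then 1 else 0) (fun w => by positivity)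
      (fun w => by split_ifs <;> norm_num) u
    simpa using this
  · intro u v
    simp [torusGreen]
  · intro u v
    convert torusGreen_laplacian hℓ hd0 S u v
  · exact fun u v => heat_nonneg _ _
  · exact hsymm S
  · exact sum_heat_sub hd0 S
  · intro u
    have h1 := hheat ℓ S hS1 (u - u)
    rw [hn'] at h1
    have hS0 : (0 : ℝ) < S := by exact_mod_cast hS1
    have hsq : (1 : ℝ) ≤ √S := Real.one_le_sqrt.2 (by exact_mod_cast hS1)
    have h2 : (1 / √S : ℝ) ^ 3 ≤ 2 / (γ * n) := calc
      (1 / √S : ℝ) ^ 3 ≤ (1 / √S) ^ 2 :=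
        pow_le_pow_of_le_one (by positivity) ((div_le_one (by linarith)).2 hsq) (by norm_num)
      _ = 1 / S := by rw [one_div_pow, Real.sq_sqrt hS0.le]
      _ ≤ 1 / (γ * n / 2) := one_div_le_one_div_of_le (by positivity) hSge
      _ = 2 / (γ * n) := by field_simp
    refine h1.trans ((add_le_add_right (mul_le_mul_of_nonneg_left h2 hA.le) _).trans
      (le_of_eq ?_))
    field_simp
  · exact sum_occ_heat_ge hd0 S
  · intro x u
    exact hpot (occ x) (occ_nonneg x) (occ_le_one x) u

end TorusGreen

theorem trajExp_numParticles_le {V : Type*} [Fintype V] [Nonempty V] {G : SimpleGraph V}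
    {p K : ℝ} {T : ℕ} (hp0 : 0 ≤ p) (hp1 : p ≤ 1) (hK : 0 ≤ K)
    (h : ∀ x, ((markovOp (kcipKernel G p))^[T] mass) x ≤ mass x / 2 + K)
    [inst : DecidableEq V] (k : ℕ) (x : V → Bool) :
    trajExp (kcipKernel G p) x (k * T) (fun ω => (numParticles (ω (Fin.last (k * T))) : ℝ)) ≤
      (1 - 1 / 2) ^ k * (numParticles x : ℝ) + 2 * K := by
  obtain rfl : inst = fun a b => Classical.propDecidable (a = b) := Subsingleton.elim _ _
  rw [trajExp_last_eq_iterate _ (fun x => (numParticles x : ℝ)), numParticles_eq_mass,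
    funext numParticles_eq_mass]
  exact iterate_markovOp_geometric (kcipKernel_nonneg G hp0 hp1) (sum_kcipKernel G p) hK h k x

/-- Drift condition for the particle count: for the KCIP on the torus
`Λ(L,d)` with `p = c/n` (`d ≥ 3` fixed, `c` fixed), there exists `ε₀ = ε₀(c,d) > 0` such
that for every `0 < ε < ε₀` there are constants `C < ∞`, `α ∈ (0,1)` and `N` (depending only
on `ε, c, d`) so that for all `n = (L+1)^d > N`, every integer `k ≥ 1` and every initial
configuration `x`: `E_x[V_{k⌊εn³⌋}] ≤ (1−α)^k V_0(x) + C`. -/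
theorem kcip_particle_drift (c : ℝ) (hc : 0 < c) (d : ℕ) (hd : 3 ≤ d) :
    ∃ ε₀ : ℝ, 0 < ε₀ ∧ ∀ ε : ℝ, 0 < ε → ε < ε₀ →
      ∃ C α : ℝ, ∃ N : ℕ, 0 < α ∧ α < 1 ∧
        ∀ L : ℕ, N < (L + 1) ^ d → ∀ k : ℕ, 1 ≤ k →
        ∀ x : (Fin d → ZMod (L + 1)) → Bool,
          trajExp (kcipKernel (torusGraph (L + 1) d) (c / (((L + 1) ^ d : ℕ) : ℝ))) x
              (k * ⌊ε * (((L + 1) ^ d : ℕ) : ℝ) ^ 3⌋₊)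
              (fun ω =>
                (numParticles (ω (Fin.last (k * ⌊ε * (((L + 1) ^ d : ℕ) : ℝ) ^ 3⌋₊))) : ℝ)) ≤
            (1 - α) ^ k * (numParticles x : ℝ) + C := by
  have hd1 : (1 : ℝ) ≤ 2 * d := by
    have : (3 : ℝ) ≤ d := by exact_mod_cast hd
    linarith
  have hd4 : (0 : ℝ) < 4 * d := by linarith
  refine ⟨1, one_pos, fun ε hε _ => ?_⟩
  obtain ⟨δ, hδ, h⟩ := exists_iterate_markovOp_mass_le hc hd1 hd4 hε
  obtain ⟨C, M, B, N, hC, hgreen⟩ := exists_isGreenKernel_torusGraph hd hδ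
  obtain ⟨K, hK, hdrift⟩ := h C M B hC
  refine ⟨2 * K, 1 / 2, N + ⌈c⌉₊ + ⌈1 / ε⌉₊, by norm_num, by norm_num, fun L hL k _ x => ?_⟩
  set n : ℝ := (((L + 1) ^ d : ℕ) : ℝ) with hn
  have hcn : c ≤ n := (Nat.le_ceil c).trans (by rw [hn]; exact_mod_cast by omega)
  have hn1 : 1 ≤ n := by rw [hn]; exact_mod_cast by omega
  have hεn : 1 ≤ ε * n ^ 3 := by
    have h1 : 1 / ε ≤ n := (Nat.le_ceil _).trans (by rw [hn]; exact_mod_cast by omega)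
    rw [div_le_iff₀ hε] at h1
    have h2 : n ≤ n ^ 3 := le_self_pow₀ hn1 (by norm_num)
    nlinarith
  obtain ⟨g, b, hgb⟩ := hgreen (L + 1) (by omega)
  have hcard : n = Fintype.card (Fin d → ZMod (L + 1)) := by simp [hn, ZMod.card]
  have hp0 : 0 ≤ c / n := by positivity
  have hp1 : c / n ≤ 1 := (div_le_one (by linarith)).2 hcn
  exact trajExp_numParticles_le hp0 hp1 hK
    (hdrift _ (torusGraph (L + 1) d) g b n hcard hgb hcn hεn) k x
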